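/- arXiv:1811.04022 — 6 statements merged into one kernel-verified Lean document; each statement's English description precedes it below -/
import Mathlib

section
/- There exist ε₀ > 0 and constants C > 0 and Cₙ > 0 (for each n ≥ 1), depending only on C_Q and C_F, such that for every f ∈ A with ‖f‖ ≤ ε and 0 < ε < ε₀, the iteration scheme u⁽¹⁾ = Qf, u⁽ⁿ⁾ = Qf − Q(F(u⁽ⁿ⁻¹⁾)) converges in A to a solution u of the integral equation u = Qf − Q(F(u)), and moreover ‖u⁽ⁿ⁾ − u‖ ≤ Cₙ εⁿ for every n ≥ 1 and ‖u‖ ≤ C ε. -/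
open Metric Set Filter Topology in
/-- The Banach fixed point theorem on a closed ball centered at the origin, in the form of a
geometric rate of convergence for the iterates. -/
theorem exists_fixedPoint_closedBall {E : Type*} [NormedAddCommGroup E] [CompleteSpace E]
    {T : E → E} {q R : ℝ} (hq : 0 ≤ q) (hq1 : q < 1)
    (hT : MapsTo T (closedBall 0 R) (closedBall 0 R))
    (hlip : ∀ u ∈ closedBall (0 : E) R, ∀ v ∈ closedBall (0 : E) R,
      ‖T u - T v‖ ≤ q * ‖u - v‖)
    {v : ℕ → E} (hv0 : v 0 ∈ closedBall (0 : E) R) (hv : ∀ n, v (n + 1) = T (v n)) :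
    ∃ u ∈ closedBall (0 : E) R, T u = u ∧ Tendsto v atTop (𝓝 u) ∧
      ∀ n, ‖v n - u‖ ≤ q ^ n * (2 * R) := by
  have hc : ContractingWith ⟨q, hq⟩ (hT.restrict T _ _) :=
    ⟨hq1, LipschitzWith.of_dist_le_mul fun x y => by
      rw [Subtype.dist_eq, Subtype.dist_eq, dist_eq_norm, dist_eq_norm]
      exact hlip x x.2 y y.2⟩
  obtain ⟨u, hu, hfix, -⟩ := hc.exists_fixedPoint' isClosed_closedBall.isComplete hT hv0
    (edist_ne_top _ _)
  have hmem : ∀ n, v n ∈ closedBall (0 : E) R := by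
    intro n
    induction n with
    | zero => exact hv0
    | succ n ih => exact hv n ▸ hT ih
  have hrate : ∀ n, ‖v n - u‖ ≤ q ^ n * (2 * R) := by
    intro n
    induction n with
    | zero =>
      rw [mem_closedBall_zero_iff] at hv0 hu
      linarith [norm_sub_le (v 0) u]
    | succ n ih =>
      calc ‖v (n + 1) - u‖ = ‖T (v n) - T u‖ := by rw [hv, hfix.eq]
        _ ≤ q * ‖v n - u‖ := hlip _ (hmem n) _ hu
        _ ≤ q * (q ^ n * (2 * R)) := by gcongr
        _ = q ^ (n + 1) * (2 * R) := by ring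
  refine ⟨u, hu, hfix, ?_, hrate⟩
  rw [tendsto_iff_norm_sub_tendsto_zero]
  refine squeeze_zero (fun _ => norm_nonneg _) hrate ?_
  simpa using (tendsto_pow_atTop_nhds_zero_of_lt_one hq hq1).mul_const (2 * R)


/-- Abstract form of Proposition 3.1: convergence of the iteration scheme
`u⁽¹⁾ = Qf`, `u⁽ⁿ⁾ = Qf − Q(F(u⁽ⁿ⁻¹⁾))` in a commutative Banach algebra `A`,
with error estimates `‖u⁽ⁿ⁾ − u‖ ≤ Cₙ εⁿ` and `‖u‖ ≤ C ε`. -/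
theorem stmt_0 {A : Type*} [NormedCommRing A] [NormedAlgebra ℝ A] [CompleteSpace A]
    (CQ CF : ℝ) :
    ∃ ε₀ : ℝ, 0 < ε₀ ∧ ∃ C : ℝ, 0 < C ∧ ∃ Cn : ℕ → ℝ, (∀ n : ℕ, 1 ≤ n → 0 < Cn n) ∧
      ∀ (Q : A →L[ℝ] A), ‖Q‖ ≤ CQ →
      ∀ (F : A → A), F 0 = 0 →
        (∀ u v : A, ‖u‖ ≤ 1 → ‖v‖ ≤ 1 → ‖F u - F v‖ ≤ CF * (‖u‖ + ‖v‖) * ‖u - v‖) →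
      ∀ ε : ℝ, 0 < ε → ε < ε₀ → ∀ f : A, ‖f‖ ≤ ε →
      ∀ uit : ℕ → A, uit 1 = Q f →
        (∀ n : ℕ, 2 ≤ n → uit n = Q f - Q (F (uit (n - 1)))) →
      ∃ u : A, Filter.Tendsto uit Filter.atTop (nhds u) ∧ u = Q f - Q (F u) ∧
        (∀ n : ℕ, 1 ≤ n → ‖uit n - u‖ ≤ Cn n * ε ^ n) ∧ ‖u‖ ≤ C * ε := by
  obtain ⟨a, ha1, haQ⟩ : ∃ a : ℝ, 1 ≤ a ∧ CQ ≤ a := ⟨max 1 CQ, le_max_left _ _, le_max_right _ _⟩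
  obtain ⟨b, hb1, hbF⟩ : ∃ b : ℝ, 1 ≤ b ∧ CF ≤ b := ⟨max 1 CF, le_max_left _ _, le_max_right _ _⟩
  have ha : 0 < a := by linarith
  have hb : 0 < b := by linarith
  refine ⟨1 / (8 * a ^ 2 * b), by positivity, 2 * a, by positivity,
    fun n => 4 * a * (4 * a ^ 2 * b) ^ (n - 1), fun n _ => by positivity, ?_⟩
  intro Q hQ F hF0 hF ε hε hε₀ f hf uit huit1 huit
  rw [lt_div_iff₀ (by positivity)] at hε₀
  have hR1 : 2 * a * ε ≤ 1 := by
    have hab : a ≤ a ^ 2 * b := by nlinarith [mul_pos ha hb, mul_pos ha ha]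
    nlinarith
  have hQa (x : A) : ‖Q x‖ ≤ a * ‖x‖ := Q.le_of_opNorm_le (hQ.trans haQ) x
  have hQF : ∀ u v : A, ‖u‖ ≤ 2 * a * ε → ‖v‖ ≤ 2 * a * ε →
      ‖Q (F u) - Q (F v)‖ ≤ a * (b * (‖u‖ + ‖v‖) * ‖u - v‖) := by
    intro u v hu hv
    calc ‖Q (F u) - Q (F v)‖ = ‖Q (F u - F v)‖ := by rw [map_sub]
      _ ≤ a * ‖F u - F v‖ := hQa _
      _ ≤ a * (CF * (‖u‖ + ‖v‖) * ‖u - v‖) := by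
        gcongr
        exact hF u v (hu.trans hR1) (hv.trans hR1)
      _ ≤ a * (b * (‖u‖ + ‖v‖) * ‖u - v‖) := by gcongr
  have hQf : ‖Q f‖ ≤ a * ε := (hQa f).trans (by gcongr)
  obtain ⟨u, hu, hfix, hlim, hrate⟩ := exists_fixedPoint_closedBall
    (T := fun u => Q f - Q (F u)) (q := 4 * a ^ 2 * b * ε) (R := 2 * a * ε)
    (v := fun n => uit (n + 1)) (by positivity) (by linarith)
    (fun u hu => by
      rw [mem_closedBall_zero_iff] at hu ⊢
      have hsmall : ‖Q (F u)‖ ≤ a * ε := by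
        calc ‖Q (F u)‖ ≤ a * (b * ‖u‖ * ‖u‖) := by
              simpa [hF0] using hQF u 0 hu (by simpa using by positivity)
          _ ≤ a * (b * (2 * a * ε) * (2 * a * ε)) := by gcongr
          _ = (4 * a ^ 2 * b * ε) * (a * ε) := by ring
          _ ≤ 1 * (a * ε) := by
            gcongr
            linarith
          _ = a * ε := one_mul _
      linarith [norm_sub_le (Q f) (Q (F u))])
    (fun u hu v hv => by
      rw [mem_closedBall_zero_iff] at hu hv
      calc ‖Q f - Q (F u) - (Q f - Q (F v))‖ = ‖Q (F u) - Q (F v)‖ := by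
            rw [sub_sub_sub_cancel_left, norm_sub_rev]
        _ ≤ a * (b * (‖u‖ + ‖v‖) * ‖u - v‖) := hQF u v hu hv
        _ ≤ a * (b * (2 * a * ε + 2 * a * ε) * ‖u - v‖) := by gcongr
        _ = 4 * a ^ 2 * b * ε * ‖u - v‖ := by ring)
    (by
      rw [mem_closedBall_zero_iff, zero_add, huit1]
      linarith [mul_pos ha hε])
    (fun n => huit (n + 1 + 1) (by lia))
  refine ⟨u, (Filter.tendsto_add_atTop_iff_nat 1).1 hlim, hfix.symm, fun n hn => ?_,
    mem_closedBall_zero_iff.1 hu⟩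
  obtain ⟨m, rfl⟩ := Nat.exists_eq_add_of_le' hn
  calc ‖uit (m + 1) - u‖ ≤ (4 * a ^ 2 * b * ε) ^ m * (2 * (2 * a * ε)) := hrate m
    _ = 4 * a * (4 * a ^ 2 * b) ^ (m + 1 - 1) * ε ^ (m + 1) := by
      rw [Nat.add_sub_cancel, mul_pow, pow_succ]
      ring
end

section
/- Let G : ℝ → ℝ be continuous, bounded and non-constant. Then for every n ≥ 1, every compact set K ⊆ ℝⁿ, every continuous function f : ℝⁿ → ℝ and every ε > 0, there exists a network function g ∈ Σⁿ(G) such that sup_{x ∈ K} |f(x) − g(x)| < ε; that is, Σⁿ(G) is dense in C(K) with respect to the uniform metric ρ_K(f,g) = sup_{x∈K}|f(x) − g(x)|. -/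
open MeasureTheory Filter Topology
open scoped ContDiff Convolution

/-- Every real polynomial has a polynomial antiderivative. -/
theorem Polynomial.exists_derivative_eq (p : Polynomial ℝ) :
    ∃ q : Polynomial ℝ, q.derivative = p := by
  induction p using Polynomial.induction_on' with
  | add p q hp hq =>
    obtain ⟨p', rfl⟩ := hp
    obtain ⟨q', rfl⟩ := hq
    exact ⟨p' + q', by simp⟩
  | monomial n a =>
    refine ⟨Polynomial.monomial (n + 1) (a / (n + 1)), ?_⟩
    have : (n : ℝ) + 1 ≠ 0 := by positivity
    simp [this]

/-- A smooth function with a vanishing iterated derivative is a polynomial function. -/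
theorem exists_polynomial_of_iteratedDeriv_eq_zero (k : ℕ) :
    ∀ f : ℝ → ℝ, ContDiff ℝ ∞ f → (∀ x, iteratedDeriv k f x = 0) →
      ∃ p : Polynomial ℝ, ∀ x, f x = p.eval x := by
  induction k with
  | zero => exact fun f _ h => ⟨0, fun x => by simpa using h x⟩
  | succ k ih =>
    intro f hf h
    obtain ⟨p, hp⟩ := ih (deriv f) (contDiff_infty_iff_deriv.1 hf).2
      fun x => by rw [← iteratedDeriv_succ', h x]
    obtain ⟨q, rfl⟩ := p.exists_derivative_eq
    have hdiff : Differentiable ℝ f := (contDiff_infty_iff_deriv.1 hf).1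
    have hconst := is_const_of_deriv_eq_zero (f := fun x => f x - q.eval x)
      (hdiff.sub q.differentiable) fun x => by
        rw [deriv_fun_sub hdiff.differentiableAt q.differentiableAt, hp, Polynomial.deriv, sub_self]
    refine ⟨q + Polynomial.C (f 0 - q.eval 0), fun x => ?_⟩
    have := hconst x 0
    simp only [Polynomial.eval_add, Polynomial.eval_C]
    linarith

/-- No iterated derivative of a bounded non-constant smooth function vanishes identically. -/
theorem exists_iteratedDeriv_ne_zero {f : ℝ → ℝ} (hf : ContDiff ℝ ∞ f) {M : ℝ}
    (hM : ∀ x, |f x| ≤ M) {s t : ℝ} (hst : f s ≠ f t) (k : ℕ) :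
    ∃ b, iteratedDeriv k f b ≠ 0 := by
  by_contra! h
  obtain ⟨p, hp⟩ := exists_polynomial_of_iteratedDeriv_eq_zero k f hf h
  have hdeg := p.isBoundedUnder_abs_atTop_iff.1
    ⟨M, eventually_map.2 (Eventually.of_forall fun x => by rw [← hp]; exact hM x)⟩
  rw [Polynomial.degree_le_zero_iff.1 hdeg] at hp
  exact hst (by simp [hp])

/-- A bounded non-constant continuous function has a bounded non-constant smooth mollification. -/
theorem exists_bump_convolution_nonconstant {G : ℝ → ℝ} (hG : Continuous G) {M : ℝ}
    (hM : ∀ t, |G t| ≤ M) {s t : ℝ} (hst : G s ≠ G t) :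
    ∃ φ : ℝ → ℝ, Continuous φ ∧ HasCompactSupport φ ∧
      ContDiff ℝ ∞ (fun x => ∫ y, φ y * G (x - y)) ∧
      (∃ M' : ℝ, ∀ x, |∫ y, φ y * G (x - y)| ≤ M') ∧
      (∫ y, φ y * G (s - y)) ≠ ∫ y, φ y * G (t - y) := by
  have hε : 0 < |G s - G t| / 3 := by
    have := abs_pos.2 (sub_ne_zero.2 hst)
    positivity
  obtain ⟨δ₁, hδ₁, h₁⟩ := Metric.continuousAt_iff.1 (hG.continuousAt (x := s)) _ hε
  obtain ⟨δ₂, hδ₂, h₂⟩ := Metric.continuousAt_iff.1 (hG.continuousAt (x := t)) _ hε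
  have hδ : 0 < min δ₁ δ₂ := lt_min hδ₁ hδ₂
  let φ : ContDiffBump (0 : ℝ) := ⟨min δ₁ δ₂ / 2, min δ₁ δ₂, by linarith, by linarith⟩
  have hconv : (φ.normed volume ⋆[ContinuousLinearMap.lsmul ℝ ℝ, volume] G) =
      fun x => ∫ y, φ.normed volume y * G (x - y) := by
    ext x
    simp [convolution_def]
  have hs := φ.dist_normed_convolution_le (μ := volume) (x₀ := s) hG.aestronglyMeasurable
    fun x hx => (h₁ (lt_of_lt_of_le (Metric.mem_ball.1 hx) (min_le_left _ _))).le
  have ht := φ.dist_normed_convolution_le (μ := volume) (x₀ := t) hG.aestronglyMeasurable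
    fun x hx => (h₂ (lt_of_lt_of_le (Metric.mem_ball.1 hx) (min_le_right _ _))).le
  have hsm := φ.hasCompactSupport_normed (μ := volume).contDiff_convolution_left
    (ContinuousLinearMap.lsmul ℝ ℝ) (n := ⊤) (φ.contDiff_normed (μ := volume))
    (hG.locallyIntegrable (μ := volume))
  rw [hconv] at hs ht hsm
  refine ⟨φ.normed volume, φ.continuous_normed, φ.hasCompactSupport_normed, hsm, ⟨M, fun x => ?_⟩,
    fun heq => ?_⟩
  · rw [← Real.norm_eq_abs]
    calc ‖∫ y, φ.normed volume y * G (x - y)‖ ≤ ∫ y, φ.normed volume y * M := by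
          refine norm_integral_le_of_norm_le (φ.integrable_normed.mul_const M)
            (Eventually.of_forall fun y => ?_)
          rw [norm_mul, Real.norm_of_nonneg (φ.nonneg_normed y)]
          exact mul_le_mul_of_nonneg_left (hM _) (φ.nonneg_normed y)
      _ = M := by rw [integral_mul_const, φ.integral_normed, one_mul]
  · simp only [Real.dist_eq] at hs ht
    rw [heq] at hs
    have h3 := abs_sub_le (G s) (∫ y, φ.normed volume y * G (t - y)) (G t)
    rw [abs_sub_comm (G s) (∫ y, φ.normed volume y * G (t - y))] at h3
    linarith

/-- The integral of a continuous compactly supported function with values in a closed subspace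
lies in that subspace. -/
theorem Submodule.integral_mem_of_continuous {E : Type*} [NormedAddCommGroup E] [NormedSpace ℝ E]
    [CompleteSpace E] {V : Submodule ℝ E} (hV : IsClosed (V : Set E)) {F : ℝ → E}
    (hF : Continuous F) (hc : HasCompactSupport F) (hmem : ∀ t, F t ∈ V) : ∫ t, F t ∈ V := by
  have : CompleteSpace V := hV.completeSpace_coe
  let F' : ℝ → V := fun t => ⟨F t, hmem t⟩
  have hF' : Continuous F' := hF.subtype_mk _
  have hc' : HasCompactSupport F' := hc.mono fun t ht => by
    simpa [F', Function.mem_support, Subtype.ext_iff] using ht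
  have := V.subtypeL.integral_comp_comm (hF'.integrable_of_hasCompactSupport hc' (μ := volume))
  have h : ∫ t, F t = V.subtypeL (∫ t, F' t) := this
  rw [h]
  exact (∫ t, F' t).2

section CompactSpace

variable {X : Type*} [TopologicalSpace X]

/-- The element `x ↦ u x ^ k * g (s * u x + b)` of `C(X, ℝ)`. -/
def powMulComp (u : C(X, ℝ)) (k : ℕ) (g : C(ℝ, ℝ)) (s b : ℝ) : C(X, ℝ) :=
  ⟨fun x => u x ^ k * g (s * u x + b), by fun_prop⟩

theorem continuous_powMulComp (u : C(X, ℝ)) (k : ℕ) (g : C(ℝ, ℝ)) (b : ℝ) :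
    Continuous fun s => powMulComp u k g s b :=
  ContinuousMap.continuous_of_continuous_uncurry _ <| by
    change Continuous fun p : ℝ × X => u p.2 ^ k * g (p.1 * u p.2 + b)
    fun_prop

variable [CompactSpace X]

/-- Differentiating in the scaling parameter gains one power of `u` and one derivative of `g`. -/
theorem hasDerivAt_powMulComp (u : C(X, ℝ)) (k : ℕ) {g g' : C(ℝ, ℝ)}
    (hg : ∀ x, HasDerivAt g (g' x) x) (s b : ℝ) :
    HasDerivAt (fun s => powMulComp u k g s b) (powMulComp u (k + 1) g' s b) s := by
  have hcont := continuous_powMulComp u (k + 1) g' b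
  have hF : (fun s => powMulComp u k g s b) =
      fun s => powMulComp u k g 0 b + ∫ r in (0 : ℝ)..s, powMulComp u (k + 1) g' r b := by
    ext s x
    have h1 := (ContinuousMap.evalCLM ℝ x).intervalIntegral_comp_comm
      (hcont.intervalIntegrable (μ := volume) 0 s)
    have h2 : ∫ r in (0 : ℝ)..s, powMulComp u (k + 1) g' r b x =
        powMulComp u k g s b x - powMulComp u k g 0 b x := by
      refine intervalIntegral.integral_eq_sub_of_hasDerivAt
        (f := fun r => powMulComp u k g r b x) (fun r _ => ?_) ?_
      · have := ((hg (r * u x + b)).comp r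
          (((hasDerivAt_id r).mul_const (u x)).add_const b)).const_mul (u x ^ k)
        refine this.congr_deriv ?_
        change u x ^ k * (g' (r * u x + b) * (1 * u x)) = u x ^ (k + 1) * g' (r * u x + b)
        ring
      · exact ((ContinuousMap.evalCLM ℝ x).continuous.comp hcont).intervalIntegrable _ _
    have h3 : (∫ r in (0 : ℝ)..s, powMulComp u (k + 1) g' r b) x =
        ∫ r in (0 : ℝ)..s, powMulComp u (k + 1) g' r b x := h1.symm
    rw [ContinuousMap.add_apply, h3, h2]
    ring
  rw [hF]
  exact (intervalIntegral.integral_hasDerivAt_right (hcont.intervalIntegrable 0 s)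
    hcont.aestronglyMeasurable.stronglyMeasurableAtFilter hcont.continuousAt).const_add _

variable {V : Submodule ℝ C(X, ℝ)} {u : C(X, ℝ)}

theorem powMulComp_mem_succ (hV : IsClosed (V : Set C(X, ℝ))) {k : ℕ} {g g' : C(ℝ, ℝ)}
    (hg : ∀ x, HasDerivAt g (g' x) x) (h : ∀ s b, powMulComp u k g s b ∈ V) (s b : ℝ) :
    powMulComp u (k + 1) g' s b ∈ V := by
  have hmem := range_deriv_subset_closure_span_image (𝕜 := ℝ)
    (fun s => powMulComp u k g s b) dense_univ (Set.mem_range_self s)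
  rw [(hasDerivAt_powMulComp u k hg s b).deriv] at hmem
  refine closure_minimal ?_ hV hmem
  rw [SetLike.coe_subset_coe, Submodule.span_le]
  rintro _ ⟨r, -, rfl⟩
  exact h r b

theorem powMulComp_iteratedDeriv_mem (hV : IsClosed (V : Set C(X, ℝ))) {g : ℝ → ℝ}
    (hg : ContDiff ℝ ∞ g) (h : ∀ s b, powMulComp u 0 ⟨g, hg.continuous⟩ s b ∈ V) (k : ℕ) :
    ∀ s b, powMulComp u k
      ⟨iteratedDeriv k g, hg.continuous_iteratedDeriv k (by exact_mod_cast le_top)⟩ s b ∈ V := by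
  induction k with
  | zero => simpa only [iteratedDeriv_zero] using h
  | succ k ih =>
    refine powMulComp_mem_succ hV (fun x => ?_) ih
    simp only [ContinuousMap.coe_mk, iteratedDeriv_succ]
    exact (hg.differentiable_iteratedDeriv k (by exact_mod_cast ENat.natCast_lt_top k) x).hasDerivAt

/-- A closed subspace of `C(X, ℝ)` containing all `x ↦ g (s * u x + b)`, for some bounded
non-constant smooth `g`, contains all powers of `u`. -/
theorem pow_mem_of_contDiff (hV : IsClosed (V : Set C(X, ℝ))) {g : ℝ → ℝ}
    (hg : ContDiff ℝ ∞ g) {M : ℝ} (hM : ∀ x, |g x| ≤ M) {p q : ℝ} (hpq : g p ≠ g q)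
    (h : ∀ s b, powMulComp u 0 ⟨g, hg.continuous⟩ s b ∈ V) (k : ℕ) : u ^ k ∈ V := by
  obtain ⟨b, hb⟩ := exists_iteratedDeriv_ne_zero hg hM hpq k
  have := V.smul_mem (iteratedDeriv k g b)⁻¹ (powMulComp_iteratedDeriv_mem hV hg h k 0 b)
  convert this using 1
  ext x
  simp [powMulComp]
  field_simp

/-- A closed subspace of `C(X, ℝ)` containing all `x ↦ G (s * u x + b)`, for some bounded
non-constant continuous `G`, contains `exp u`. -/
theorem exp_mem_of_comp_mem (hV : IsClosed (V : Set C(X, ℝ))) {G : ℝ → ℝ} (hG : Continuous G)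
    {M : ℝ} (hM : ∀ x, |G x| ≤ M) {p q : ℝ} (hpq : G p ≠ G q)
    (h : ∀ s b, powMulComp u 0 ⟨G, hG⟩ s b ∈ V) : NormedSpace.exp u ∈ V := by
  obtain ⟨φ, hφ, hφc, hsm, ⟨M', hM'⟩, hne⟩ := exists_bump_convolution_nonconstant hG hM hpq
  have hpow : ∀ k, u ^ k ∈ V := by
    refine pow_mem_of_contDiff hV hsm hM' hne fun s b => ?_
    have hcont : Continuous fun y => φ y • powMulComp u 0 ⟨G, hG⟩ s (b - y) := by
      refine hφ.smul (ContinuousMap.continuous_of_continuous_uncurry _ ?_)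
      change Continuous fun z : ℝ × X => u z.2 ^ 0 * G (s * u z.2 + (b - z.1))
      fun_prop
    have hcs : HasCompactSupport fun y => φ y • powMulComp u 0 ⟨G, hG⟩ s (b - y) :=
      hφc.smul_right
    convert Submodule.integral_mem_of_continuous hV hcont hcs fun y => V.smul_mem _ (h s (b - y))
      using 1
    ext x
    have hev := (ContinuousMap.evalCLM ℝ x).integral_comp_comm
      (hcont.integrable_of_hasCompactSupport hcs (μ := volume))
    refine Eq.trans ?_ hev
    simp [powMulComp, add_sub_assoc]
  refine hV.mem_of_tendsto (NormedSpace.exp_series_hasSum_exp' (𝕂 := ℝ) u)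
    (Eventually.of_forall fun A => V.sum_mem fun k _ => V.smul_mem _ (hpow k))

end CompactSpace

/-- A closed subspace of `C(X, ℝ)` containing the exponentials of an additive submonoid that
separates points is everything. -/
theorem eq_top_of_exp_mem {X : Type*} [TopologicalSpace X] [CompactSpace X]
    {V : Submodule ℝ C(X, ℝ)} (hV : IsClosed (V : Set C(X, ℝ))) (L : AddSubmonoid C(X, ℝ))
    (hL : ∀ x y, x ≠ y → ∃ u ∈ L, u x ≠ u y) (hexp : ∀ u ∈ L, NormedSpace.exp u ∈ V) :
    V = ⊤ := by
  let S : Submonoid C(X, ℝ) :=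
    { carrier := NormedSpace.exp '' L
      one_mem' := ⟨0, L.zero_mem, NormedSpace.exp_zero⟩
      mul_mem' := by
        rintro _ _ ⟨u, hu, rfl⟩ ⟨v, hv, rfl⟩
        exact ⟨u + v, L.add_mem hu hv, NormedSpace.exp_add⟩ }
  have hexp_apply : ∀ (u : C(X, ℝ)) (x : X), NormedSpace.exp u x = Real.exp (u x) := fun u x => by
    have := NormedSpace.map_exp (ContinuousMap.evalAlgHom ℝ ℝ x)
      (continuous_eval_const x) u
    simpa [Real.exp_eq_exp_ℝ] using this
  have hadj : Subalgebra.toSubmodule (Algebra.adjoin ℝ (S : Set C(X, ℝ))) ≤ V := by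
    rw [Algebra.adjoin_eq_span, Submonoid.closure_eq, Submodule.span_le]
    rintro _ ⟨u, hu, rfl⟩
    exact hexp u hu
  have hdense := ContinuousMap.subalgebra_topologicalClosure_eq_top_of_separatesPoints
    (Algebra.adjoin ℝ (S : Set C(X, ℝ))) fun x y hxy => by
      obtain ⟨u, hu, hne⟩ := hL x y hxy
      refine ⟨_, ⟨NormedSpace.exp u, Algebra.subset_adjoin ⟨u, hu, rfl⟩, rfl⟩, ?_⟩
      change NormedSpace.exp u x ≠ NormedSpace.exp u y
      rw [hexp_apply, hexp_apply]
      exact fun h => hne (Real.exp_injective h)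
  refine eq_top_iff.2 fun f _ => closure_minimal hadj hV ?_
  have : f ∈ (Algebra.adjoin ℝ (S : Set C(X, ℝ))).topologicalClosure := hdense ▸ Algebra.mem_top
  exact this

/-- Universal approximation (Theorem 4.1 of the paper, after Hornik): for a
continuous, bounded, non-constant activation `G`, the single-hidden-layer
network functions `x ↦ Σⱼ βⱼ G(⟨wⱼ, x⟩ + bⱼ)` are dense in `C(K)` for every
compact `K ⊆ ℝⁿ`. -/
theorem stmt_7 (G : ℝ → ℝ) (hGcont : Continuous G) (hGbdd : ∃ M : ℝ, ∀ t : ℝ, |G t| ≤ M)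
    (hGnonconst : ∃ s t : ℝ, G s ≠ G t) :
    ∀ n : ℕ, 1 ≤ n → ∀ K : Set (Fin n → ℝ), IsCompact K →
    ∀ f : (Fin n → ℝ) → ℝ, Continuous f → ∀ ε : ℝ, 0 < ε →
    ∃ (q : ℕ) (β b : Fin q → ℝ) (w : Fin q → Fin n → ℝ),
      ∀ x ∈ K, |f x - ∑ j, β j * G ((∑ i, w j i * x i) + b j)| < ε := by
  intro n _ K hK f hf ε hε
  obtain ⟨M, hM⟩ := hGbdd
  obtain ⟨p, q, hpq⟩ := hGnonconst
  have : CompactSpace K := isCompact_iff_compactSpace.1 hK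
  have hlin (w : Fin n → ℝ) : Continuous fun x : K => ∑ i, w i * x.1 i :=
    continuous_finsetSum _ fun i _ =>
      continuous_const.mul ((continuous_apply i).comp continuous_subtype_val)
  let lin (w : Fin n → ℝ) : C(K, ℝ) := ⟨fun x => ∑ i, w i * x.1 i, hlin w⟩
  let neuron (a : (Fin n → ℝ) × ℝ) : C(K, ℝ) :=
    ⟨fun x => G ((∑ i, a.1 i * x.1 i) + a.2), hGcont.comp ((hlin a.1).add continuous_const)⟩
  let W : Submodule ℝ C(K, ℝ) := Submodule.span ℝ (Set.range neuron)
  have hclosed : IsClosed (W.topologicalClosure : Set C(K, ℝ)) := W.isClosed_topologicalClosure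
  let L : AddSubmonoid C(K, ℝ) :=
    { carrier := Set.range lin
      zero_mem' := ⟨0, by ext x; simp [lin]⟩
      add_mem' := by
        rintro _ _ ⟨v, rfl⟩ ⟨w, rfl⟩
        exact ⟨v + w, by ext x; simp [lin, add_mul, Finset.sum_add_distrib]⟩ }
  have htop : W.topologicalClosure = ⊤ := by
    refine eq_top_of_exp_mem hclosed L (fun x y hxy => ?_) ?_
    · obtain ⟨i, hi⟩ := Function.ne_iff.1 (Subtype.coe_injective.ne hxy)
      exact ⟨lin (Pi.single i 1), ⟨_, rfl⟩, by simpa [lin, Pi.single_apply] using hi⟩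
    · rintro _ ⟨w, rfl⟩
      refine exp_mem_of_comp_mem hclosed hGcont hM hpq fun s b =>
        W.le_topologicalClosure (Submodule.subset_span ⟨(s • w, b), ?_⟩)
      ext x
      simp [neuron, lin, powMulComp, Finset.mul_sum, mul_assoc]
  have hmem : (⟨fun x => f x.1, by fun_prop⟩ : C(K, ℝ)) ∈ closure (W : Set C(K, ℝ)) := by
    rw [← Submodule.topologicalClosure_coe, htop]
    trivial
  obtain ⟨g, hgW, hg⟩ := Metric.mem_closure_iff.1 hmem ε hε
  obtain ⟨c, rfl⟩ := (Finsupp.mem_span_range_iff_exists_finsupp).1 hgW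
  let e := c.support.equivFin
  refine ⟨c.support.card, fun j => c (e.symm j), fun j => (e.symm j).1.2, fun j => (e.symm j).1.1,
    fun x hx => ?_⟩
  have hlt := lt_of_le_of_lt (ContinuousMap.dist_apply_le_dist (⟨x, hx⟩ : K)) hg
  rw [Real.dist_eq] at hlt
  have hsum : ∑ j, c (e.symm j) * G ((∑ i, (e.symm j).1.1 i * x i) + (e.symm j).1.2) =
      (c.sum fun a r => r • neuron a) ⟨x, hx⟩ := by
    rw [Finsupp.sum, ContinuousMap.coe_sum, Finset.sum_apply, ← Finset.sum_coe_sort c.support]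
    exact e.symm.sum_comp fun a => c a * G ((∑ i, a.1.1 i * x i) + a.1.2)
  rw [hsum]
  exact hlt
end

section
/- Let l ≥ 0 be an integer and let G : ℝ → ℝ be of class C^l, non-constant, with 0 < ∫_ℝ |G^{(l)}(t)| dt < ∞. Then for every integer m with 0 ≤ m ≤ l, every n ≥ 1, every function f : ℝⁿ → ℝ of class C^m, every compact set K ⊆ ℝⁿ and every ε > 0, there exists a network function g ∈ Σⁿ(G) such that Σ_{|α| ≤ m} sup_{x ∈ K} |∂^α f(x) − ∂^α g(x)| < ε, where the sum is over multi-indices α of order at most m; that is, Σⁿ(G) is dense in C^m with respect to the metric ρ^m_K. -/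
/-- Iterated directional (partial) derivative of `f : ℝⁿ → ℝ` along a list of
coordinate directions. -/
noncomputable def pderivList {n : ℕ} : List (Fin n) → ((Fin n → ℝ) → ℝ) → (Fin n → ℝ) → ℝ
  | [], f => f
  | i :: L, f => pderivList L fun x => fderiv ℝ f x (Pi.single i 1)

/-- Multi-index partial derivative `∂^α f` of `f : ℝⁿ → ℝ`. -/
noncomputable def pderivMulti {n : ℕ} (α : Fin n → ℕ) (f : (Fin n → ℝ) → ℝ) :
    (Fin n → ℝ) → ℝ :=
  pderivList ((List.finRange n).flatMap fun i => List.replicate (α i) i) f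

open MeasureTheory Complex FourierTransform Convolution
open scoped Real ContDiff

theorem exists_fourier_ne_zero {ψ : ℝ → ℂ} (hc : Continuous ψ) (hi : Integrable ψ)
    (h0 : ψ ≠ 0) : ∃ a : ℝ, a ≠ 0 ∧ 𝓕 ψ a ≠ 0 := by
  by_contra! h
  have hcont : Continuous (𝓕 ψ) := VectorFourier.fourierIntegral_continuous
    Real.continuous_fourierChar (by exact continuous_inner) hi
  have hz : 𝓕 ψ = 0 :=
    hcont.ext_on (dense_compl_singleton (0 : ℝ)) continuous_zero fun a ha => h a ha
  refine h0 ?_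
  rw [← hc.fourierInv_fourier_eq hi (by rw [hz]; exact integrable_zero _ _ _), hz]
  ext v
  simp [Real.fourierInv_eq]

theorem iteratedDeriv_ofReal_comp {G : ℝ → ℝ} {l : ℕ} (hG : ContDiff ℝ l G) {k : ℕ} (hk : k ≤ l) :
    iteratedDeriv k (fun t => (G t : ℂ)) = fun t => ((iteratedDeriv k G t : ℝ) : ℂ) := by
  induction k with
  | zero => simp
  | succ k ih =>
    ext t
    rw [iteratedDeriv_succ, ih (by omega), iteratedDeriv_succ]
    exact ((hG.differentiable_iteratedDeriv k (by exact_mod_cast hk) t).hasDerivAt.ofReal_comp).deriv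

theorem iteratedDeriv_eq_zero_of_notMem_tsupport {φ : ℝ → ℂ} {t : ℝ} (ht : t ∉ tsupport φ) (k : ℕ) :
    iteratedDeriv k φ t = 0 := by
  have h : iteratedFDeriv ℝ k φ t = 0 := by
    by_contra hne
    exact ht (support_iteratedFDeriv_subset k hne)
  simp [iteratedDeriv, h]

theorem hasCompactSupport_iteratedDeriv {φ : ℝ → ℂ} (hs : HasCompactSupport φ) (k : ℕ) :
    HasCompactSupport (iteratedDeriv k φ) :=
  HasCompactSupport.intro hs fun _ ht => iteratedDeriv_eq_zero_of_notMem_tsupport ht k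

theorem hasCompactSupport_comp_sub {E : Type*} [Zero E] {φ : ℝ → E} (hs : HasCompactSupport φ)
    (s : ℝ) : HasCompactSupport fun t => φ (s - t) :=
  hs.comp_homeomorph (Homeomorph.subLeft s)

theorem integral_iteratedDeriv_mul_comp_sub {φ g : ℝ → ℂ} {l : ℕ} (hφ : ContDiff ℝ ∞ φ)
    (hs : HasCompactSupport φ) (hg : ContDiff ℝ l g) (s : ℝ) (a b j : ℕ) (h : b + j ≤ l) :
    ∫ v, iteratedDeriv (a + j) φ v * iteratedDeriv b g (s - v) =
      ∫ v, iteratedDeriv a φ v * iteratedDeriv (b + j) g (s - v) := by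
  induction j generalizing a with
  | zero => rfl
  | succ j ih =>
    have hφc (k : ℕ) : Continuous (iteratedDeriv k φ) :=
      hφ.continuous_iteratedDeriv k (by exact_mod_cast le_top)
    have hgc (k : ℕ) (hk : k ≤ l) : Continuous (iteratedDeriv k g) :=
      hg.continuous_iteratedDeriv k (by exact_mod_cast hk)
    have hint (k k' : ℕ) (hk : k' ≤ l) :
        Integrable fun v => iteratedDeriv k φ v * iteratedDeriv k' g (s - v) :=
      ((hφc k).mul ((hgc k' hk).comp (continuous_const.sub continuous_id))).integrable_of_hasCompactSupport
        (hasCompactSupport_iteratedDeriv hs k).mul_right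
    rw [show a + (j + 1) = a + 1 + j by ring, ih (a + 1) (by omega)]
    have hu (v : ℝ) : HasDerivAt (iteratedDeriv a φ) (iteratedDeriv (a + 1) φ v) v := by
      rw [iteratedDeriv_succ]
      exact (hφ.differentiable_iteratedDeriv a (by exact_mod_cast WithTop.coe_lt_top _) v).hasDerivAt
    have hv (v : ℝ) : HasDerivAt (fun v => iteratedDeriv (b + j) g (s - v))
        (-iteratedDeriv (b + j + 1) g (s - v)) v := by
      rw [iteratedDeriv_succ]
      exact (hg.differentiable_iteratedDeriv (b + j)
        (by exact_mod_cast h) (s - v)).hasDerivAt.comp_const_sub s v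
    have := integral_mul_deriv_eq_deriv_mul_of_integrable (u := iteratedDeriv a φ)
      (v := fun v => iteratedDeriv (b + j) g (s - v)) (fun v _ => hu v) (fun v _ => hv v)
      (by convert! (hint a (b + j + 1) h).neg using 1; ext v; simp) (hint (a + 1) (b + j) (by omega))
      (hint a (b + j) (by omega))
    simp only [mul_neg, integral_neg, neg_inj] at this
    exact this.symm

theorem exists_smooth_fourier_ne_zero (a : ℝ) :
    ∃ φ : ℝ → ℂ, ContDiff ℝ ∞ φ ∧ HasCompactSupport φ ∧ 𝓕 φ a ≠ 0 := by
  let χ : ContDiffBump (0 : ℝ) := ⟨1, 2, one_pos, one_lt_two⟩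
  refine ⟨fun x => (χ x : ℂ) * cexp (2 * π * a * x * I), ?_, ?_, ?_⟩
  · have h1 : ContDiff ℝ ∞ fun x => (χ x : ℂ) := ofRealCLM.contDiff.comp χ.contDiff
    have h2 : ContDiff ℝ ∞ fun x : ℝ => (x : ℂ) := ofRealCLM.contDiff
    fun_prop
  · exact (χ.hasCompactSupport.comp_left ofReal_zero).mul_right
  · rw [Real.fourier_real_eq_integral_exp_smul]
    have : ∀ v : ℝ, cexp (↑(-2 * π * v * a) * I) • ((χ v : ℂ) * cexp (2 * π * a * v * I)) =
        ((χ v : ℝ) : ℂ) := fun v => by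
      rw [smul_eq_mul, mul_left_comm, ← Complex.exp_add]
      have : (↑(-2 * π * v * a) * I + 2 * π * a * v * I : ℂ) = 0 := by push_cast; ring
      rw [this, Complex.exp_zero, mul_one]
    simp only [this]
    rw [integral_complex_ofReal]
    exact_mod_cast (χ.integral_pos (μ := volume)).ne'

section PartialDerivatives

variable {n : ℕ}

theorem contDiff_fderiv_apply_single {f : (Fin n → ℝ) → ℝ} {k : ℕ}
    (hf : ContDiff ℝ (k + 1 : ℕ) f) (i : Fin n) :
    ContDiff ℝ k fun x => fderiv ℝ f x (Pi.single i 1) :=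
  (hf.fderiv_right (m := k) (by push_cast; rfl)).clm_apply contDiff_const

theorem continuous_pderivList {L : List (Fin n)} {f : (Fin n → ℝ) → ℝ}
    (hf : ContDiff ℝ L.length f) : Continuous (pderivList L f) := by
  induction L generalizing f with
  | nil => exact hf.continuous
  | cons i L ih => exact ih (contDiff_fderiv_apply_single hf i)

theorem hasCompactSupport_fderiv_apply_single {f : (Fin n → ℝ) → ℝ} (hs : HasCompactSupport f)
    (i : Fin n) : HasCompactSupport fun x => fderiv ℝ f x (Pi.single i 1) :=
  hs.fderiv_apply ℝ (Pi.single i 1)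

theorem hasCompactSupport_pderivList (L : List (Fin n)) {f : (Fin n → ℝ) → ℝ}
    (hs : HasCompactSupport f) : HasCompactSupport (pderivList L f) := by
  induction L generalizing f with
  | nil => exact hs
  | cons i L ih => exact ih (hasCompactSupport_fderiv_apply_single hs i)

theorem pderivList_congr (L : List (Fin n)) {f g : (Fin n → ℝ) → ℝ} {x : Fin n → ℝ}
    (h : f =ᶠ[nhds x] g) : pderivList L f x = pderivList L g x := by
  induction L generalizing f g with
  | nil => exact h.eq_of_nhds
  | cons i L ih => exact ih (h.fderiv.fun_comp fun A => A (Pi.single i 1))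

theorem pderivList_network {q : ℕ} (L : List (Fin n)) {G : ℝ → ℝ} (hG : ContDiff ℝ L.length G)
    (β b : Fin q → ℝ) (w : Fin q → Fin n → ℝ) :
    pderivList L (fun y => ∑ j, β j * G ((∑ i, w j i * y i) + b j)) = fun y =>
      ∑ j, β j * ((L.map (w j)).prod * iteratedDeriv L.length G ((∑ i, w j i * y i) + b j)) := by
  induction L generalizing G β with
  | nil => simp [pderivList]
  | cons k L ih =>
    have hd : Differentiable ℝ G := hG.differentiable (by simp)
    have hG' : ContDiff ℝ L.length (deriv G) :=
      ((contDiff_succ_iff_deriv (n := L.length)).1 (by simpa using hG)).2.2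
    have key (y : Fin n → ℝ) :
        fderiv ℝ (fun y => ∑ j, β j * G ((∑ i, w j i * y i) + b j)) y (Pi.single k 1) =
          ∑ j, (β j * w j k) * deriv G ((∑ i, w j i * y i) + b j) := by
      have h (j : Fin q) : HasFDerivAt (fun y : Fin n → ℝ => β j * G ((∑ i, w j i * y i) + b j))
          (β j • deriv G ((∑ i, w j i * y i) + b j) •
            ∑ i, w j i • ContinuousLinearMap.proj (R := ℝ) (φ := fun _ : Fin n => ℝ) i) y := by
        refine HasFDerivAt.const_mul ?_ _
        refine (hd _).hasDerivAt.comp_hasFDerivAt y (HasFDerivAt.add_const _ ?_)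
        exact HasFDerivAt.fun_sum fun i _ => (hasFDerivAt_apply i y).const_mul (w j i)
      rw [(HasFDerivAt.fun_sum fun j _ => h j).fderiv]
      simp only [_root_.sum_apply, _root_.smul_apply, smul_eq_mul,
        ContinuousLinearMap.proj_apply, Pi.single_apply, mul_ite, mul_one, mul_zero,
        Finset.sum_ite_eq', Finset.mem_univ, if_true]
      exact Finset.sum_congr rfl fun j _ => by ring
    simp only [pderivList, key]
    rw [ih hG']
    ext y
    refine Finset.sum_congr rfl fun j _ => ?_
    rw [List.length_cons, iteratedDeriv_succ', List.map_cons, List.prod_cons]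
    ring

/-- The character `x ↦ exp (2πi ⟨ξ, x⟩)` of `ℝⁿ`. -/
noncomputable def planeWave (ξ x : Fin n → ℝ) : ℂ :=
  cexp (((2 * π * ∑ i, ξ i * x i : ℝ) : ℂ) * I)

theorem continuous_planeWave (ξ : Fin n → ℝ) : Continuous (planeWave ξ) := by
  unfold planeWave; fun_prop

theorem planeWave_add (ξ x y : Fin n → ℝ) :
    planeWave ξ (x + y) = planeWave ξ x * planeWave ξ y := by
  rw [planeWave, planeWave, planeWave, ← Complex.exp_add, ← add_mul, ← ofReal_add]
  simp only [Pi.add_apply, mul_add, Finset.sum_add_distrib]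

theorem planeWave_neg_mul_self (ξ x : Fin n → ℝ) : planeWave (-ξ) x * planeWave ξ x = 1 := by
  rw [planeWave, planeWave, ← Complex.exp_add, ← add_mul, ← ofReal_add]
  simp

theorem hasFDerivAt_planeWave (ξ x : Fin n → ℝ) : HasFDerivAt (planeWave ξ)
    ((∑ i, ξ i • ContinuousLinearMap.proj (R := ℝ) (φ := fun _ : Fin n => ℝ) i).smulRight
      (2 * π * I * planeWave ξ x)) x := by
  have h : HasFDerivAt (fun x : Fin n → ℝ => ∑ i, ξ i * x i)
      (∑ i, ξ i • ContinuousLinearMap.proj (R := ℝ) (φ := fun _ : Fin n => ℝ) i) x :=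
    HasFDerivAt.fun_sum fun i _ => (hasFDerivAt_apply i x).const_mul (ξ i)
  have h2 (t : ℝ) : HasDerivAt (fun t : ℝ => cexp (((2 * π * t : ℝ) : ℂ) * I))
      (2 * π * I * cexp (((2 * π * t : ℝ) : ℂ) * I)) t := by
    have := (((hasDerivAt_id t).const_mul (2 * π)).ofReal_comp.mul_const I).cexp
    convert! this using 1
    simp only [id, mul_one, ofReal_mul, ofReal_ofNat]
    ring
  have := (h2 _).hasFDerivAt.comp x h
  convert! this using 1

theorem integral_planeWave_mul_fderiv {f : (Fin n → ℝ) → ℝ} (hf : ContDiff ℝ 1 f)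
    (hs : HasCompactSupport f) (ξ : Fin n → ℝ) (i : Fin n) :
    ∫ y, planeWave (-ξ) y * ((fderiv ℝ f y (Pi.single i 1) : ℝ) : ℂ) =
      2 * π * I * ξ i * ∫ y, planeWave (-ξ) y * (f y : ℂ) := by
  have hd : Differentiable ℝ f := hf.differentiable one_ne_zero
  have hfc : Continuous fun y => (f y : ℂ) := continuous_ofReal.comp hf.continuous
  have hsc : HasCompactSupport fun y => (f y : ℂ) := hs.comp_left ofReal_zero
  have hfd (y : Fin n → ℝ) : fderiv ℝ (fun y => (f y : ℂ)) y (Pi.single i 1) =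
      ((fderiv ℝ f y (Pi.single i 1) : ℝ) : ℂ) := by
    have h : HasFDerivAt (fun y => (f y : ℂ)) (ofRealCLM ∘L fderiv ℝ f y) y :=
      ofRealCLM.hasFDerivAt.comp y (hd y).hasFDerivAt
    simp [h.fderiv]
  have hpd (y : Fin n → ℝ) : fderiv ℝ (planeWave (-ξ)) y (Pi.single i 1) =
      -(2 * π * I * ξ i) * planeWave (-ξ) y := by
    rw [(hasFDerivAt_planeWave _ y).fderiv]
    simp [Pi.single_apply]
    ring
  have hpc := continuous_planeWave (-ξ)
  have hdc : Continuous fun y => ((fderiv ℝ f y (Pi.single i 1) : ℝ) : ℂ) :=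
    continuous_ofReal.comp (contDiff_fderiv_apply_single (k := 0) (by simpa using hf) i).continuous
  have hi : Integrable fun y => planeWave (-ξ) y * (f y : ℂ) :=
    (hpc.mul hfc).integrable_of_hasCompactSupport hsc.mul_left
  have := integral_mul_fderiv_eq_neg_fderiv_mul_of_integrable (μ := volume) (f := planeWave (-ξ))
    (g := fun y => (f y : ℂ)) (v := Pi.single i 1)
    (by simpa only [hpd, mul_assoc] using hi.const_mul _)
    (by
      simp only [hfd]
      exact (hpc.mul hdc).integrable_of_hasCompactSupport
        ((hasCompactSupport_fderiv_apply_single hs i).comp_left ofReal_zero).mul_left)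
    hi (fun y _ => (hasFDerivAt_planeWave _ y).differentiableAt)
    (fun y _ => (ofRealCLM.differentiableAt).comp y (hd y))
  simp only [hfd, hpd] at this
  rw [this, ← integral_neg, ← integral_const_mul]
  congr 1 with y
  ring

theorem integral_planeWave_mul_pderivList {L : List (Fin n)} {f : (Fin n → ℝ) → ℝ}
    (hf : ContDiff ℝ L.length f) (hs : HasCompactSupport f) (ξ : Fin n → ℝ) :
    ∫ y, planeWave (-ξ) y * ((pderivList L f y : ℝ) : ℂ) =
      (L.map fun i => 2 * π * I * (ξ i : ℂ)).prod * ∫ y, planeWave (-ξ) y * (f y : ℂ) := by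
  induction L generalizing f with
  | nil => simp [pderivList]
  | cons i L ih =>
    rw [pderivList, ih (contDiff_fderiv_apply_single hf i)
      (hasCompactSupport_fderiv_apply_single hs i), integral_planeWave_mul_fderiv
      (hf.of_le (by simp)) hs, List.map_cons, List.prod_cons]
    ring

theorem eq_zero_of_integral_planeWave_eq_zero {u : (Fin n → ℝ) → ℂ} (hu : Continuous u)
    (hs : HasCompactSupport u) (h : ∀ ξ, ∫ y, planeWave (-ξ) y * u y = 0) : u = 0 := by
  let e := EuclideanSpace.equiv (Fin n) ℝ
  let v : EuclideanSpace ℝ (Fin n) → ℂ := fun y => u (WithLp.ofLp y)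
  have hv : Continuous v := hu.comp e.continuous
  have hvs : HasCompactSupport v := hs.comp_homeomorph e.toHomeomorph
  have hF : 𝓕 v = 0 := by
    ext ξ
    rw [Real.fourier_eq', Pi.zero_apply, ← h (WithLp.ofLp ξ),
      ← (PiLp.volume_preserving_ofLp (Fin n)).integral_comp
        (MeasurableEquiv.toLp 2 (Fin n → ℝ)).symm.measurableEmbedding]
    congr 1 with y
    simp only [v, smul_eq_mul, planeWave, PiLp.inner_apply, Pi.neg_apply, neg_mul,
      Finset.sum_neg_distrib, mul_neg]
    rfl
  have hvz : v = 0 := by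
    rw [← hv.fourierInv_fourier_eq (hv.integrable_of_hasCompactSupport hvs)
      (by rw [hF]; exact integrable_zero _ _ _), hF]
    ext y
    simp [Real.fourierInv_eq]
  ext y
  exact congrFun hvz (WithLp.toLp 2 y)

end PartialDerivatives

section WeightedIntegral

variable {T E : Type*} [TopologicalSpace T] [MeasurableSpace T] [OpensMeasurableSpace T]
  {μ : Measure T} [IsFiniteMeasureOnCompacts μ] [NormedAddCommGroup E] [NormedSpace ℂ E]
  {c : T → ℂ} {F : T → E}

theorem integrable_smul_of_hasCompactSupport (hc : Continuous c) (hF : Continuous F)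
    (hs : HasCompactSupport c ∨ HasCompactSupport F) : Integrable (fun t => c t • F t) μ :=
  (hc.smul hF).integrable_of_hasCompactSupport
    (hs.elim (fun h => h.smul_right) fun h => h.smul_left)

theorem integral_smul_apply_eq [CompleteSpace E] (Λ : E →L[ℂ] ℂ) (hc : Continuous c)
    (hF : Continuous F) (hs : HasCompactSupport c ∨ HasCompactSupport F) :
    ∫ t, c t • Λ (F t) ∂μ = Λ (∫ t, c t • F t ∂μ) := by
  rw [← Λ.integral_comp_comm (integrable_smul_of_hasCompactSupport hc hF hs)]
  simp only [map_smul]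

end WeightedIntegral

section Density

variable {n : ℕ} {ι : Type*} {K : Set (Fin n → ℝ)}

/-- The curve `t ↦ Ψ t |_K` of continuous functions attached to a jointly continuous family. -/
noncomputable def restrictCurve (K : Set (Fin n → ℝ)) {T : Type*} [TopologicalSpace T]
    (Ψ : T → (Fin n → ℝ) → ι → ℂ) (h : Continuous fun p : T × (Fin n → ℝ) => Ψ p.1 p.2) :
    C(T, C(K, ι → ℂ)) :=
  ContinuousMap.curry ⟨fun p : T × K => Ψ p.1 p.2,
    h.comp (continuous_fst.prodMk (continuous_subtype_val.comp continuous_snd))⟩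

theorem restrictCurve_apply {T : Type*} [TopologicalSpace T]
    (Ψ : T → (Fin n → ℝ) → ι → ℂ) (h : Continuous fun p : T × (Fin n → ℝ) => Ψ p.1 p.2)
    (t : T) (x : K) (i : ι) : restrictCurve K Ψ h t x i = Ψ t x i := rfl

variable [Fintype ι] [CompactSpace K]

/-- Evaluation at a point and an index, as a continuous functional. -/
noncomputable def evalEval (x : K) (i : ι) : C(K, ι → ℂ) →L[ℂ] ℂ :=
  (ContinuousLinearMap.proj (R := ℂ) (φ := fun _ : ι => ℂ) i) ∘L (ContinuousMap.evalCLM ℂ x)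

theorem integral_smul_apply_apply {T : Type*} [TopologicalSpace T] [MeasurableSpace T]
    [OpensMeasurableSpace T] {μ : Measure T} [IsFiniteMeasureOnCompacts μ]
    {c : T → ℂ} {F : T → C(K, ι → ℂ)} (hc : Continuous c) (hF : Continuous F)
    (hs : HasCompactSupport c ∨ HasCompactSupport F) (x : K) (i : ι) :
    (∫ t, c t • F t ∂μ) x i = ∫ t, c t * F t x i ∂μ :=
  (integral_smul_apply_eq (evalEval x i) hc hF hs).symm

theorem exists_frequency_annihilated {l : ℕ} {g : ℝ → ℂ} (hg : ContDiff ℝ l g)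
    (hgi : Integrable (iteratedDeriv l g)) (hg0 : iteratedDeriv l g ≠ 0)
    (L : ι → List (Fin n)) (hL : ∀ i, (L i).length ≤ l) (Λ : C(K, ι → ℂ) →L[ℂ] ℂ)
    (hΛ : ∀ (R : C(K, ι → ℂ)) (w : Fin n → ℝ) (b : ℝ), (∀ x i, R x i =
      (((L i).map w).prod : ℝ) * iteratedDeriv (L i).length g ((∑ j, w j * x.1 j) + b)) →
      Λ R = 0) :
    ∃ a : ℝ, a ≠ 0 ∧ ∀ (R : C(K, ι → ℂ)) (w : Fin n → ℝ), (∀ x i, R x i =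
      (((L i).map w).prod : ℝ) * (2 * π * I * a) ^ (L i).length * planeWave (a • w) x) →
      Λ R = 0 := by
  have hgc (k : ℕ) (hk : k ≤ l) : Continuous (iteratedDeriv k g) :=
    hg.continuous_iteratedDeriv k (by exact_mod_cast hk)
  obtain ⟨a, ha, hψa⟩ := exists_fourier_ne_zero (hgc l le_rfl) hgi hg0
  obtain ⟨φ, hφ, hs, hφa⟩ := exists_smooth_fourier_ne_zero a
  refine ⟨a, ha, fun R w hR => ?_⟩
  have hφc (k : ℕ) : Continuous (iteratedDeriv k φ) :=
    hφ.continuous_iteratedDeriv k (by exact_mod_cast le_top)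
  have hφi (k : ℕ) : Integrable (iteratedDeriv k φ) :=
    (hφc k).integrable_of_hasCompactSupport (hasCompactSupport_iteratedDeriv hs k)
  have hdot : Continuous fun x : Fin n → ℝ => ∑ j, w j * x j := by fun_prop
  have harg : Continuous fun p : ℝ × (Fin n → ℝ) => (∑ j, w j * p.2 j) + p.1 := by fun_prop
  let Θ : C(ℝ, C(K, ι → ℂ)) := restrictCurve K (fun b x i => (((L i).map w).prod : ℝ) *
      iteratedDeriv (L i).length φ ((∑ j, w j * x j) + b))
    (continuous_pi fun i => continuous_const.mul ((hφc _).comp harg))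
  let Γ : C(ℝ, C(K, ι → ℂ)) := restrictCurve K (fun b x i => (((L i).map w).prod : ℝ) *
      iteratedDeriv (L i).length g ((∑ j, w j * x j) + b))
    (continuous_pi fun i => continuous_const.mul ((hgc _ (hL i)).comp harg))
  have hΘs : HasCompactSupport Θ := by
    obtain ⟨M, hM⟩ := (isCompact_iff_compactSpace.2 ‹_› : IsCompact K).exists_bound_of_continuousOn
      hdot.continuousOn
    obtain ⟨r, hr⟩ := hs.isBounded.exists_norm_le
    refine HasCompactSupport.intro (isCompact_closedBall (0 : ℝ) (M + r)) fun b hb => ?_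
    ext x i
    have : (∑ j, w j * x.1 j) + b ∉ tsupport φ := fun hmem => hb <| by
      have h1 := hr _ hmem
      have h2 := hM x.1 x.2
      rw [mem_closedBall_zero_iff]
      have h3 := norm_sub_le ((∑ j, w j * x.1 j) + b) (∑ j, w j * x.1 j)
      rw [add_sub_cancel_left] at h3
      linarith
    simp [Θ, restrictCurve_apply, iteratedDeriv_eq_zero_of_notMem_tsupport this]
  have hθc : Continuous fun b => Λ (Θ b) := Λ.continuous.comp Θ.continuous
  have hθi : Integrable fun b => Λ (Θ b) :=
    hθc.integrable_of_hasCompactSupport (hΘs.comp_left (map_zero Λ))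
  have hconv : ((iteratedDeriv l g) ⋆[ContinuousLinearMap.lsmul ℂ ℂ] fun b => Λ (Θ b)) = 0 := by
    ext b
    have hsub {E : Type _} [TopologicalSpace E] {F : ℝ → E} (hF : Continuous F) :
        Continuous fun t => F (b - t) := hF.comp (continuous_const.sub continuous_id)
    have hψc := hgc l le_rfl
    have hΘb : HasCompactSupport fun u => Θ (b - u) := hasCompactSupport_comp_sub hΘs b
    have hφs := hasCompactSupport_iteratedDeriv hs l
    have heq : ∫ u, iteratedDeriv l g u • Θ (b - u) = ∫ v, iteratedDeriv l φ v • Γ (b - v) := by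
      ext x i
      rw [integral_smul_apply_apply hψc (hsub Θ.continuous) (.inr hΘb),
        integral_smul_apply_apply (hφc l) (hsub Γ.continuous) (.inl hφs)]
      simp only [Θ, Γ, restrictCurve_apply,
        mul_left_comm _ (((List.map w (L i)).prod : ℝ) : ℂ), integral_const_mul]
      congr 1
      have hp := integral_iteratedDeriv_mul_comp_sub hφ hs hg ((∑ j, w j * x.1 j) + b)
        (L i).length (L i).length (l - (L i).length) (by have := hL i; omega)
      rw [Nat.add_sub_cancel' (hL i)] at hp
      simp only [← add_sub_assoc]
      rw [hp, ← integral_sub_left_eq_self _ volume ((∑ j, w j * x.1 j) + b)]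
      simp only [sub_sub_cancel, mul_comm]
    change ∫ u, iteratedDeriv l g u • Λ (Θ (b - u)) = 0
    rw [integral_smul_apply_eq Λ hψc (hsub Θ.continuous) (.inr hΘb), heq,
      ← integral_smul_apply_eq Λ (hφc l) (hsub Γ.continuous) (.inl hφs)]
    simp only [hΛ (Γ _) w _ fun x i => rfl, smul_zero, integral_zero]
  have hθa : 𝓕 (fun b => Λ (Θ b)) a = 0 := by
    have := Real.fourier_smul_convolution_eq hgi hθi a
    rw [hconv] at this
    have h0 : 𝓕 (0 : ℝ → ℂ) a = 0 := by simp [Real.fourier_real_eq]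
    rw [h0] at this
    exact (smul_eq_zero.1 this.symm).resolve_left hψa
  have hR' : 𝓕 (fun b => Λ (Θ b)) a = 𝓕 φ a * Λ R := by
    have hec : Continuous fun b : ℝ => cexp (↑(-2 * π * b * a) * I) := by fun_prop
    rw [Real.fourier_real_eq_integral_exp_smul,
      integral_smul_apply_eq Λ hec Θ.continuous (.inr hΘs),
      ← smul_eq_mul (𝓕 φ a), ← map_smul]
    congr 1
    ext x i
    rw [integral_smul_apply_apply hec Θ.continuous (.inr hΘs)]
    have hF := congrFun (Real.fourier_iteratedDeriv (N := ⊤) (n := (L i).length) hφ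
      (fun k _ => hφi k) le_top) a
    simp only [Real.fourier_real_eq_integral_exp_smul (iteratedDeriv _ φ), smul_eq_mul] at hF
    have hrhs : (𝓕 φ a • R) x i = (((L i).map w).prod : ℝ) * planeWave (a • w) x.1 *
        ((2 * π * I * a) ^ (L i).length * 𝓕 φ a) := by
      rw [ContinuousMap.smul_apply, Pi.smul_apply, smul_eq_mul, hR]
      ring
    rw [hrhs, ← hF, ← integral_const_mul, ← integral_add_left_eq_self
      (fun v => _ * (cexp (↑(-2 * π * v * a) * I) * _)) (∑ j, w j * x.1 j)]
    congr 1 with b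
    have hexp : cexp (↑(-2 * π * b * a) * I) = planeWave (a • w) x.1 *
        cexp (↑(-2 * π * ((∑ j, w j * x.1 j) + b) * a) * I) := by
      rw [planeWave, ← Complex.exp_add, ← add_mul, ← ofReal_add]
      simp only [Pi.smul_apply, smul_eq_mul, mul_assoc, ← Finset.mul_sum]
      congr 3
      ring
    rw [hexp]
    simp only [Θ, restrictCurve_apply]
    ring
  exact (mul_eq_zero.1 (hR' ▸ hθa)).resolve_left hφa

theorem annihilates_planeWave {l : ℕ} {g : ℝ → ℂ} (hg : ContDiff ℝ l g)
    (hgi : Integrable (iteratedDeriv l g)) (hg0 : iteratedDeriv l g ≠ 0)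
    (L : ι → List (Fin n)) (hL : ∀ i, (L i).length ≤ l) (Λ : C(K, ι → ℂ) →L[ℂ] ℂ)
    (hΛ : ∀ (R : C(K, ι → ℂ)) (w : Fin n → ℝ) (b : ℝ), (∀ x i, R x i =
      (((L i).map w).prod : ℝ) * iteratedDeriv (L i).length g ((∑ j, w j * x.1 j) + b)) →
      Λ R = 0)
    (ξ : Fin n → ℝ) (R : C(K, ι → ℂ))
    (hR : ∀ x i, R x i = ((L i).map fun j => 2 * π * I * (ξ j : ℂ)).prod * planeWave ξ x) :
    Λ R = 0 := by
  obtain ⟨a, ha, h⟩ := exists_frequency_annihilated hg hgi hg0 L hL Λ hΛ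
  refine h R (a⁻¹ • ξ) fun x i => ?_
  rw [hR, smul_inv_smul₀ ha]
  congr 1
  induction L i with
  | nil => simp
  | cons j M ih =>
    have ha' : (a : ℂ) ≠ 0 := by exact_mod_cast ha
    simp only [List.map_cons, List.prod_cons, List.length_cons, pow_succ, ih, Pi.smul_apply,
      smul_eq_mul, ofReal_mul, ofReal_inv]
    field_simp

theorem annihilates_pderivList {f : (Fin n → ℝ) → ℝ} (hs : HasCompactSupport f)
    (L : ι → List (Fin n)) (hf : ∀ i, ContDiff ℝ (L i).length f) (Λ : C(K, ι → ℂ) →L[ℂ] ℂ)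
    (hΛ : ∀ (ξ : Fin n → ℝ) (R : C(K, ι → ℂ)), (∀ x i, R x i =
      ((L i).map fun j => 2 * π * I * (ξ j : ℂ)).prod * planeWave ξ x) → Λ R = 0)
    (R : C(K, ι → ℂ)) (hR : ∀ x i, R x i = (pderivList (L i) f x : ℝ)) : Λ R = 0 := by
  let F : C(Fin n → ℝ, C(K, ι → ℂ)) := restrictCurve K
    (fun y x i => ((pderivList (L i) f (x + y) : ℝ) : ℂ))
    (continuous_pi fun i => continuous_ofReal.comp ((continuous_pderivList (hf i)).comp
      (continuous_snd.add continuous_fst)))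
  have hFs : HasCompactSupport F := by
    obtain ⟨M, hM⟩ := (isCompact_iff_compactSpace.2 ‹_› : IsCompact K).isBounded.exists_norm_le
    obtain ⟨r, hr⟩ := (isCompact_iUnion fun i =>
      hasCompactSupport_pderivList (L i) hs).isBounded.exists_norm_le
    refine HasCompactSupport.intro (isCompact_closedBall (0 : Fin n → ℝ) (M + r)) fun y hy => ?_
    ext x i
    have : x.1 + y ∉ tsupport (pderivList (L i) f) := fun hmem => hy <| by
      have h1 := hr _ (Set.mem_iUnion_of_mem i hmem)
      have h2 := hM x.1 x.2
      rw [mem_closedBall_zero_iff]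
      have h3 := norm_sub_le (x.1 + y) x.1
      rw [add_sub_cancel_left] at h3
      linarith
    simp [F, restrictCurve_apply, image_eq_zero_of_notMem_tsupport this]
  have hu : (fun y => Λ (F y)) = 0 := by
    refine eq_zero_of_integral_planeWave_eq_zero (Λ.continuous.comp F.continuous)
      (hFs.comp_left (map_zero Λ)) fun ξ => ?_
    have hpc := continuous_planeWave (-ξ)
    refine (integral_smul_apply_eq Λ hpc F.continuous (.inr hFs)).trans ?_
    let E : C(K, ι → ℂ) := ⟨fun x i => ((L i).map fun j => 2 * π * I * (ξ j : ℂ)).prod *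
      planeWave ξ x, continuous_pi fun i => continuous_const.mul
        ((continuous_planeWave ξ).comp continuous_subtype_val)⟩
    have hE : ∫ y, planeWave (-ξ) y • F y = (∫ y, planeWave (-ξ) y * (f y : ℂ)) • E := by
      ext x i
      rw [integral_smul_apply_apply hpc F.continuous (.inr hFs)]
      have hshift (y : Fin n → ℝ) : planeWave (-ξ) y * F y x i =
          planeWave ξ x.1 * (planeWave (-ξ) (x.1 + y) * (pderivList (L i) f (x.1 + y) : ℝ)) := by
        rw [planeWave_add, ← mul_assoc, ← mul_assoc, mul_comm (planeWave ξ x.1),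
          planeWave_neg_mul_self, one_mul]
        rfl
      simp only [hshift]
      rw [integral_const_mul, integral_add_left_eq_self
        (fun y => planeWave (-ξ) y * ((pderivList (L i) f y : ℝ) : ℂ)),
        integral_planeWave_mul_pderivList (hf i) hs]
      simp only [ContinuousMap.smul_apply, Pi.smul_apply, smul_eq_mul, E, ContinuousMap.coe_mk]
      ring
    rw [hE, map_smul, hΛ ξ E fun x i => rfl, smul_zero]
  have h0 : F 0 = R := by
    ext x i
    simp [F, restrictCurve_apply, hR]
  rw [← h0]
  exact congrFun hu 0

end Density

theorem exists_dual_annihilator {E : Type*} [NormedAddCommGroup E] [NormedSpace ℂ E]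
    (S : Submodule ℂ E) {v : E} (hv : v ∉ closure (S : Set E)) :
    ∃ Λ : E →L[ℂ] ℂ, (∀ s ∈ S, Λ s = 0) ∧ Λ v ≠ 0 := by
  rw [← Submodule.topologicalClosure_coe] at hv
  obtain ⟨Λ, c, hΛ, hc⟩ := RCLike.geometric_hahn_banach_closed_point (𝕜 := ℂ)
    (S.topologicalClosure.restrictScalars ℝ).convex S.isClosed_topologicalClosure hv
  have hc0 : 0 < c := by simpa using hΛ 0 (zero_mem S.topologicalClosure)
  refine ⟨Λ, fun s hs => ?_, fun h => ?_⟩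
  · by_contra hne
    have := hΛ (((c : ℂ) * (Λ s)⁻¹) • s)
      (S.topologicalClosure.smul_mem _ (S.le_topologicalClosure hs))
    simp [hne] at this
  · rw [h, map_zero] at hc
    exact absurd hc hc0.not_gt

theorem exists_network_pderivList_close {l : ℕ} {G : ℝ → ℝ} (hG : ContDiff ℝ l G)
    (hGi : Integrable (iteratedDeriv l G)) (hG0 : iteratedDeriv l G ≠ 0) {n : ℕ} {ι : Type*}
    [Fintype ι] (L : ι → List (Fin n)) (hL : ∀ i, (L i).length ≤ l) {f : (Fin n → ℝ) → ℝ}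
    (hf : ∀ i, ContDiff ℝ (L i).length f) {K : Set (Fin n → ℝ)} (hK : IsCompact K)
    {ε : ℝ} (hε : 0 < ε) :
    ∃ (q : ℕ) (β b : Fin q → ℝ) (w : Fin q → Fin n → ℝ), ∀ i, ∀ x ∈ K,
      |pderivList (L i) f x -
        pderivList (L i) (fun y => ∑ j, β j * G ((∑ i, w j i * y i) + b j)) x| < ε := by
  have : CompactSpace K := isCompact_iff_compactSpace.1 hK
  obtain ⟨M, hM0, hM⟩ := hK.isBounded.exists_pos_norm_lt
  let χ : ContDiffBump (0 : Fin n → ℝ) := ⟨M, M + 1, hM0, lt_add_one M⟩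
  have hχf (i : ι) {x : Fin n → ℝ} (hx : x ∈ K) :
      pderivList (L i) (fun y => χ y * f y) x = pderivList (L i) f x := by
    refine pderivList_congr _ ?_
    have hb : x ∈ Metric.ball (0 : Fin n → ℝ) χ.rIn := by simpa [χ] using hM x hx
    filter_upwards [χ.eventuallyEq_one_of_mem_ball hb] with y hy
    simp [hy]
  have hg : ContDiff ℝ l fun t => (G t : ℂ) := ofRealCLM.contDiff.comp hG
  have hgl (k : ℕ) (hk : k ≤ l) := iteratedDeriv_ofReal_comp hG hk
  have hGc (k : ℕ) (hk : k ≤ l) : Continuous (iteratedDeriv k G) :=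
    hG.continuous_iteratedDeriv k (by exact_mod_cast hk)
  let P (p : (Fin n → ℝ) × ℝ) : C(K, ι → ℂ) :=
    ⟨fun x i => (((L i).map p.1).prod : ℝ) *
      ((iteratedDeriv (L i).length G ((∑ j, p.1 j * x.1 j) + p.2) : ℝ) : ℂ),
      continuous_pi fun i => continuous_const.mul (continuous_ofReal.comp
        ((hGc _ (hL i)).comp ((continuous_finsetSum _ fun j _ => continuous_const.mul
          ((continuous_apply j).comp continuous_subtype_val)).add continuous_const)))⟩
  let F : C(K, ι → ℂ) := ⟨fun x i => (pderivList (L i) (fun y => χ y * f y) x.1 : ℝ),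
    continuous_pi fun i => continuous_ofReal.comp ((continuous_pderivList
      (χ.contDiff.mul (hf i))).comp continuous_subtype_val)⟩
  have hF : F ∈ closure (Submodule.span ℂ (Set.range P) : Set C(K, ι → ℂ)) := by
    by_contra hnot
    obtain ⟨Λ, hΛ, hne⟩ := exists_dual_annihilator _ hnot
    refine hne (annihilates_pderivList (f := fun y => χ y * f y) χ.hasCompactSupport.mul_right L
      (fun i => χ.contDiff.mul (hf i)) Λ (fun ξ R hR => ?_) F fun x i => rfl)
    refine annihilates_planeWave hg (by rw [hgl l le_rfl]; exact hGi.ofReal) ?_ L hL Λ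
      (fun R w b hR => ?_) ξ R hR
    · rw [hgl l le_rfl]
      exact fun h => hG0 (funext fun t => by simpa using congrFun h t)
    · have : R = P (w, b) := by
        ext x i
        rw [hR, hgl _ (hL i)]
        rfl
      rw [this]
      exact hΛ _ (Submodule.subset_span ⟨_, rfl⟩)
  obtain ⟨R, hR, hdist⟩ := Metric.mem_closure_iff.1 hF ε hε
  obtain ⟨q, c, p, rfl⟩ : ∃ (q : ℕ) (c : Fin q → ℂ) (p : Fin q → (Fin n → ℝ) × ℝ),
      ∑ j, c j • P (p j) = R := by
    obtain ⟨q, c, v, hv⟩ := Submodule.mem_span_set'.1 hR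
    choose p hp using fun j => (v j).2
    exact ⟨q, c, p, by simpa only [hp] using hv⟩
  refine ⟨q, fun j => (c j).re, fun j => (p j).2, fun j => (p j).1, fun i x hx => ?_⟩
  rw [pderivList_network _ (hG.of_le (by exact_mod_cast hL i)), ← hχf i hx]
  refine lt_of_le_of_lt ?_ hdist
  have hre : pderivList (L i) (fun y => χ y * f y) x - ∑ j, (c j).re *
      (((L i).map (p j).1).prod *
        iteratedDeriv (L i).length G ((∑ k, (p j).1 k * x k) + (p j).2)) =
      ((F - ∑ j, c j • P (p j)) ⟨x, hx⟩ i).re := by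
    simp only [F, P, ContinuousMap.sub_apply, ContinuousMap.sum_apply, Finset.sum_apply,
      ContinuousMap.smul_apply, Pi.sub_apply, Pi.smul_apply, smul_eq_mul, ContinuousMap.coe_mk,
      ← ofReal_mul, sub_re, re_sum, re_mul_ofReal, ofReal_re]
  rw [hre, dist_eq_norm]
  exact (abs_re_le_norm _).trans ((norm_le_pi_norm _ i).trans
    ((F - ∑ j, c j • P (p j)).norm_coe_le_norm ⟨x, hx⟩))

theorem length_flatMap_replicate {n : ℕ} (α : Fin n → ℕ) :
    ((List.finRange n).flatMap fun i => List.replicate (α i) i).length = ∑ i, α i := by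
  simp [List.length_flatMap, ← List.ofFn_eq_map, List.sum_ofFn]

/-- Derivative-norm universal approximation (Theorem 4.2 of the paper, after
Hornik's Corollary 3.4): if `G` is `C^l`, non-constant, with
`0 < ∫ |G^{(l)}| < ∞`, then for each `0 ≤ m ≤ l` the network functions are
dense in `C^m` with respect to the metric `ρ^m_K`. -/
theorem stmt_8 (l : ℕ) (G : ℝ → ℝ) (hGsmooth : ContDiff ℝ l G)
    (hGnonconst : ∃ s t : ℝ, G s ≠ G t)
    (hGint : MeasureTheory.Integrable (fun t : ℝ => iteratedDeriv l G t))
    (hGpos : 0 < ∫ t : ℝ, |iteratedDeriv l G t|) :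
    ∀ m : ℕ, m ≤ l → ∀ n : ℕ, 1 ≤ n →
    ∀ f : (Fin n → ℝ) → ℝ, ContDiff ℝ m f →
    ∀ K : Set (Fin n → ℝ), IsCompact K → ∀ ε : ℝ, 0 < ε →
    ∃ (q : ℕ) (β b : Fin q → ℝ) (w : Fin q → Fin n → ℝ),
      ∑ α ∈ (Finset.Iic (fun _ => m : Fin n → ℕ)).filter (fun α => ∑ i, α i ≤ m),
        ⨆ x : K, |pderivMulti α f x -
          pderivMulti α (fun y => ∑ j, β j * G ((∑ i, w j i * y i) + b j)) x| < ε := by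
  intro m hm n _ f hf K hK ε hε
  set A := (Finset.Iic (fun _ => m : Fin n → ℕ)).filter (fun α => ∑ i, α i ≤ m)
  have hG0 : iteratedDeriv l G ≠ 0 := fun h => by simp [h] at hGpos
  have hlen (α : A) :
      ((List.finRange n).flatMap fun i => List.replicate (α.1 i) i).length ≤ m := by
    rw [length_flatMap_replicate]
    exact (Finset.mem_filter.1 α.2).2
  have hδ : 0 < ε / (A.card + 1) := by positivity
  obtain ⟨q, β, b, w, h⟩ := exists_network_pderivList_close hGsmooth hGint hG0
    (fun α : A => (List.finRange n).flatMap fun i => List.replicate (α.1 i) i)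
    (fun α => (hlen α).trans hm) (fun α => hf.of_le (by exact_mod_cast hlen α)) hK hδ
  refine ⟨q, β, b, w, ?_⟩
  calc _ ≤ ∑ _α ∈ A, ε / (A.card + 1) :=
        Finset.sum_le_sum fun α hα => Real.iSup_le (fun x => (h ⟨α, hα⟩ x.1 x.2).le) hδ.le
    _ = A.card / (A.card + 1) * ε := by rw [Finset.sum_const, nsmul_eq_mul]; ring
    _ < ε := by
        refine mul_lt_of_lt_one_left hε ?_
        rw [div_lt_one (by positivity)]
        exact lt_add_one _
end

section
/- Let F(u) = Σ_{k=2}^N a_k u^k with fixed a₂, …, a_N ∈ A. Define the network by h⁽⁰⁾ = Qf and h⁽ᵐ⁾ = h⁽⁰⁾ − Q(F(h⁽ᵐ⁻¹⁾)) for m ≥ 1. Then there exists ε₀ > 0 and, for each depth M ≥ 0, a constant C_M > 0, both depending only on C_Q, N and the norms ‖a_k‖, such that whenever ‖f‖ ≤ ε with 0 < ε < ε₀ and u ∈ A is a solution of u = Qf − Q(F(u)) with ‖u‖ ≤ 2C_Q ε, the depth-M network output satisfies ‖u − h⁽ᴹ⁾‖ ≤ C_M ε^{M+1}. -/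
theorem norm_pow_succ_sub_pow_succ_le {A : Type*} [NormedCommRing A] {r : ℝ} {v w : A}
    (hv : ‖v‖ ≤ r) (hw : ‖w‖ ≤ r) (n : ℕ) :
    ‖v ^ (n + 1) - w ^ (n + 1)‖ ≤ ((n + 1 : ℕ) : ℝ) * r ^ n * ‖v - w‖ := by
  have hr : 0 ≤ r := (norm_nonneg v).trans hv
  induction n with
  | zero => simp
  | succ n ih =>
    have hpow : ‖v ^ (n + 1)‖ ≤ r ^ (n + 1) :=
      (norm_pow_le' v n.succ_pos).trans (by gcongr)
    calc ‖v ^ (n + 1 + 1) - w ^ (n + 1 + 1)‖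
        = ‖v ^ (n + 1) * (v - w) + (v ^ (n + 1) - w ^ (n + 1)) * w‖ := by
          congr 1; ring
      _ ≤ ‖v ^ (n + 1)‖ * ‖v - w‖ + ‖v ^ (n + 1) - w ^ (n + 1)‖ * ‖w‖ :=
          (norm_add_le _ _).trans (add_le_add (norm_mul_le _ _) (norm_mul_le _ _))
      _ ≤ r ^ (n + 1) * ‖v - w‖ + (((n + 1 : ℕ) : ℝ) * r ^ n * ‖v - w‖) * r := by
          gcongr
      _ = ((n + 1 + 1 : ℕ) : ℝ) * r ^ (n + 1) * ‖v - w‖ := by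
          push_cast; ring

/-- On a ball of radius `r ≤ 1`, a polynomial without constant and linear terms is Lipschitz
with constant proportional to `r`. -/
theorem norm_sum_mul_pow_sub_le {A : Type*} [NormedCommRing A] {N : ℕ} {a : ℕ → A}
    {b : ℕ → ℝ} (hab : ∀ k, ‖a k‖ ≤ b k) {r : ℝ} (hr : r ≤ 1) {v w : A}
    (hv : ‖v‖ ≤ r) (hw : ‖w‖ ≤ r) :
    ‖∑ k ∈ Finset.Icc 2 N, a k * v ^ k - ∑ k ∈ Finset.Icc 2 N, a k * w ^ k‖ ≤
      (∑ k ∈ Finset.Icc 2 N, |b k| * k) * r * ‖v - w‖ := by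
  have hr0 : 0 ≤ r := (norm_nonneg v).trans hv
  rw [← Finset.sum_sub_distrib, Finset.sum_mul, Finset.sum_mul]
  refine norm_sum_le_of_le _ fun k hk => ?_
  obtain ⟨n, rfl⟩ : ∃ n, k = n + 1 + 1 := ⟨k - 2, by have := (Finset.mem_Icc.mp hk).1; omega⟩
  have hpow : r ^ (n + 1) ≤ r := pow_le_of_le_one hr0 hr n.succ_ne_zero
  calc ‖a (n + 1 + 1) * v ^ (n + 1 + 1) - a (n + 1 + 1) * w ^ (n + 1 + 1)‖
      ≤ ‖a (n + 1 + 1)‖ * ‖v ^ (n + 1 + 1) - w ^ (n + 1 + 1)‖ := by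
        rw [← mul_sub]; exact norm_mul_le _ _
    _ ≤ |b (n + 1 + 1)| * (((n + 1 + 1 : ℕ) : ℝ) * r * ‖v - w‖) := by
        gcongr
        · exact (hab _).trans (le_abs_self _)
        · exact (norm_pow_succ_sub_pow_succ_le hv hw (n + 1)).trans (by gcongr)
    _ = |b (n + 1 + 1)| * ((n + 1 + 1 : ℕ) : ℝ) * r * ‖v - w‖ := by ring


/-- Abstract form of Theorem 5.1: the depth-`M` network
`h⁽⁰⁾ = Qf`, `h⁽ᵐ⁾ = h⁽⁰⁾ − Q(F(h⁽ᵐ⁻¹⁾))`, built from the solution operator `Q`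
and the polynomial activation `F(u) = Σ_{k=2}^N a_k uᵏ`, approximates the
solution of `u = Qf − Q(F(u))` to order `ε^{M+1}`. -/
theorem stmt_9 {A : Type*} [NormedCommRing A] [NormedAlgebra ℝ A] [CompleteSpace A]
    (CQ : ℝ) (N : ℕ) (Ak : ℕ → ℝ) :
    ∃ ε₀ : ℝ, 0 < ε₀ ∧ ∃ C : ℕ → ℝ, (∀ M : ℕ, 0 < C M) ∧
      ∀ (Q : A →L[ℝ] A), ‖Q‖ ≤ CQ →
      ∀ (a : ℕ → A), (∀ k, ‖a k‖ ≤ Ak k) →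
      ∀ (F : A → A), (∀ v : A, F v = ∑ k ∈ Finset.Icc 2 N, a k * v ^ k) →
      ∀ ε : ℝ, 0 < ε → ε < ε₀ → ∀ f : A, ‖f‖ ≤ ε →
      ∀ u : A, u = Q f - Q (F u) → ‖u‖ ≤ 2 * CQ * ε →
      ∀ h : ℕ → A, h 0 = Q f → (∀ m : ℕ, h (m + 1) = h 0 - Q (F (h m))) →
      ∀ M : ℕ, ‖u - h M‖ ≤ C M * ε ^ (M + 1) := by
  obtain ⟨D, hD1, hCD⟩ : ∃ D : ℝ, 1 ≤ D ∧ CQ ≤ D := ⟨max 1 CQ, le_max_left _ _, le_max_right _ _⟩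
  obtain ⟨L, hL1, hSL⟩ : ∃ L : ℝ, 1 ≤ L ∧ ∑ k ∈ Finset.Icc 2 N, |Ak k| * k ≤ L :=
    ⟨max 1 _, le_max_left _ _, le_max_right _ _⟩
  have hD : 0 < D := by linarith
  have hL : 0 < L := by linarith
  refine ⟨1 / (4 * D ^ 2 * L), by positivity, fun M => D * (2 * D ^ 2 * L) ^ M,
    fun M => by positivity, ?_⟩
  intro Q hQ a ha F hF ε hε hε' f hf u hu hur h h0 hs M
  rw [lt_div_iff₀ (by positivity)] at hε'
  have hr0 : 0 ≤ 2 * D * ε := by positivity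
  have hDL : D ≤ D ^ 2 * L := by nlinarith [mul_le_mul hD1 hL1 zero_le_one hD.le]
  have hr1 : 2 * D * ε ≤ 1 := by nlinarith [mul_le_mul_of_nonneg_left hDL hε.le]
  have hQD (x : A) : ‖Q x‖ ≤ D * ‖x‖ := Q.le_of_opNorm_le (hQ.trans hCD) x
  have hQf : ‖Q f‖ ≤ D * ε := (hQD f).trans (by gcongr)
  have hur' : ‖u‖ ≤ 2 * D * ε := hur.trans (by gcongr)
  have hlip {v w : A} (hv : ‖v‖ ≤ 2 * D * ε) (hw : ‖w‖ ≤ 2 * D * ε) :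
      ‖Q (F v) - Q (F w)‖ ≤ 2 * D ^ 2 * L * ε * ‖v - w‖ := by
    rw [← map_sub]
    calc ‖Q (F v - F w)‖ ≤ D * ‖F v - F w‖ := hQD _
      _ ≤ D * (L * (2 * D * ε) * ‖v - w‖) := by
          gcongr
          rw [hF, hF]
          exact (norm_sum_mul_pow_sub_le ha hr1 hv hw).trans (by gcongr)
      _ = 2 * D ^ 2 * L * ε * ‖v - w‖ := by ring
  have hF0 : F 0 = 0 := by
    rw [hF]
    refine Finset.sum_eq_zero fun k hk => ?_
    rw [zero_pow (by have := (Finset.mem_Icc.mp hk).1; omega), mul_zero]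
  have hball {v : A} (hv : ‖v‖ ≤ 2 * D * ε) : ‖Q (F v)‖ ≤ D * ε := by
    have h1 := hlip hv (w := 0) (by simpa using hr0)
    rw [hF0, map_zero, sub_zero, sub_zero] at h1
    calc ‖Q (F v)‖ ≤ 2 * D ^ 2 * L * ε * (2 * D * ε) := h1.trans (by gcongr)
      _ = ε * (4 * D ^ 2 * L) * (D * ε) := by ring
      _ ≤ 1 * (D * ε) := by gcongr
      _ = D * ε := one_mul _
  have hh (m : ℕ) : ‖h m‖ ≤ 2 * D * ε := by
    induction m with
    | zero => rw [h0]; nlinarith [mul_pos hD hε]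
    | succ m ih =>
      rw [hs, h0]
      linarith [norm_sub_le (Q f) (Q (F (h m))), hball ih]
  induction M with
  | zero =>
    have : u - h 0 = -Q (F u) := by rw [h0]; nth_rewrite 1 [hu]; abel
    rw [this, norm_neg]
    simpa using hball hur'
  | succ m ih =>
    have : u - h (m + 1) = -(Q (F u) - Q (F (h m))) := by
      rw [hs, h0]; nth_rewrite 1 [hu]; abel
    rw [this, norm_neg]
    calc ‖Q (F u) - Q (F (h m))‖ ≤ 2 * D ^ 2 * L * ε * ‖u - h m‖ := hlip hur' (hh m)
      _ ≤ 2 * D ^ 2 * L * ε * (D * (2 * D ^ 2 * L) ^ m * ε ^ (m + 1)) := by gcongr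
      _ = D * (2 * D ^ 2 * L) ^ (m + 1) * ε ^ (m + 1 + 1) := by ring
end

section
/- Let F : A → A and G : A → A both satisfy F(0) = G(0) = 0 and the Moser-type estimate with constant C_F on the unit ball. There exists ε₀ > 0 depending only on C_Q and C_F such that: if ‖f‖ ≤ ε with 0 < ε < ε₀, if u_F is a solution of u = Qf − Q(F(u)) and u_G is a solution of u = Qf − Q(G(u)) with ‖u_F‖ ≤ 2C_Q ε and ‖u_G‖ ≤ 2C_Q ε, and if sup{‖F(v) − G(v)‖ : v ∈ A, ‖v‖ ≤ 2C_Q ε} ≤ η, then ‖u_F − u_G‖ ≤ 2 C_Q η. -/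
/-- Stability of the small solution under uniform perturbation of the nonlinearity:
if `F` and `G` are `η`-close on the ball of radius `2C_Q ε`, the corresponding
solutions satisfy `‖u_F − u_G‖ ≤ 2 C_Q η`. -/
theorem stmt_10 {A : Type*} [NormedCommRing A] [NormedAlgebra ℝ A] [CompleteSpace A]
    (CQ CF : ℝ) :
    ∃ ε₀ : ℝ, 0 < ε₀ ∧
      ∀ (Q : A →L[ℝ] A), ‖Q‖ ≤ CQ →
      ∀ (F G : A → A), F 0 = 0 → G 0 = 0 →
        (∀ u v : A, ‖u‖ ≤ 1 → ‖v‖ ≤ 1 → ‖F u - F v‖ ≤ CF * (‖u‖ + ‖v‖) * ‖u - v‖) →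
        (∀ u v : A, ‖u‖ ≤ 1 → ‖v‖ ≤ 1 → ‖G u - G v‖ ≤ CF * (‖u‖ + ‖v‖) * ‖u - v‖) →
      ∀ ε : ℝ, 0 < ε → ε < ε₀ → ∀ f : A, ‖f‖ ≤ ε →
      ∀ uF uG : A, uF = Q f - Q (F uF) → uG = Q f - Q (G uG) →
        ‖uF‖ ≤ 2 * CQ * ε → ‖uG‖ ≤ 2 * CQ * ε →
      ∀ η : ℝ, (∀ v : A, ‖v‖ ≤ 2 * CQ * ε → ‖F v - G v‖ ≤ η) →
        ‖uF - uG‖ ≤ 2 * CQ * η := by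
  refine ⟨1 / (2 * |CQ| + 8 * CQ ^ 2 * |CF| + 1), by positivity, ?_⟩
  intro Q hQ F G _ _ hF _ ε hε hε₀ f _ uF uG huF huG hnF hnG η hη
  have hCQ : 0 ≤ CQ := (norm_nonneg Q).trans hQ
  rw [abs_of_nonneg hCQ, lt_div_iff₀ (by positivity)] at hε₀
  have hCQε : 0 ≤ CQ * ε := by positivity
  have hCFε : 0 ≤ CQ ^ 2 * |CF| * ε := by positivity
  have hball : 2 * CQ * ε ≤ 1 := by linarith
  have hcontr : CQ * (|CF| * (4 * CQ * ε)) ≤ 1 / 2 := by linarith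
  have hdiff : uF - uG = Q ((G uG - F uG) + (F uG - F uF)) := by
    calc uF - uG = (Q f - Q (F uF)) - (Q f - Q (G uG)) := by rw [← huF, ← huG]
      _ = Q ((G uG - F uG) + (F uG - F uF)) := by simp only [map_add, map_sub]; abel
  have hclose : ‖G uG - F uG‖ ≤ η := by
    rw [norm_sub_rev]
    exact hη uG hnG
  have hmoser : ‖F uG - F uF‖ ≤ |CF| * (4 * CQ * ε) * ‖uF - uG‖ := by
    calc ‖F uG - F uF‖ ≤ CF * (‖uG‖ + ‖uF‖) * ‖uG - uF‖ :=
          hF uG uF (hnG.trans hball) (hnF.trans hball)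
      _ ≤ |CF| * (4 * CQ * ε) * ‖uG - uF‖ := by
          gcongr
          · exact le_abs_self CF
          · linarith
      _ = |CF| * (4 * CQ * ε) * ‖uF - uG‖ := by rw [norm_sub_rev uG]
  have hbound : ‖uF - uG‖ ≤ CQ * (η + |CF| * (4 * CQ * ε) * ‖uF - uG‖) := by
    calc ‖uF - uG‖ ≤ CQ * ‖(G uG - F uG) + (F uG - F uF)‖ := by
          conv_lhs => rw [hdiff]
          exact Q.le_of_opNorm_le hQ _
      _ ≤ CQ * (η + |CF| * (4 * CQ * ε) * ‖uF - uG‖) := by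
          gcongr
          exact norm_add_le_of_le hclose hmoser
  have hhalf := mul_le_mul_of_nonneg_right hcontr (norm_nonneg (uF - uG))
  linarith
end

section
/- Let u ∈ X and let a₁, …, a_N, b₁, …, b_N be real scalars. Define the product recursion p⁽¹⁾ = u·(a₁ u + b₁·1), p⁽ᵏ⁾ = u·(a_k p⁽ᵏ⁻¹⁾ + b_k·1), and the paraproduct network recursion h⁽¹⁾ = B(u, a₁ u + b₁·1), h⁽ᵏ⁾ = B(u, a_k h⁽ᵏ⁻¹⁾ + b_k·1), for 2 ≤ k ≤ N. Then p⁽ᴺ⁾ − h⁽ᴺ⁾ ∈ Y and ‖p⁽ᴺ⁾ − h⁽ᴺ⁾‖_Y ≤ C (1 + ‖u‖_X)^{N+1}, where C depends only on N, the constants C_M, C_B, C_D, C_M′ and max_k (|a_k| + |b_k|). -/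
/-- One step of the comparison between the Horner recursion `q ↦ u * (a q + b)` and the
paraproduct recursion `g ↦ B u (a g + b)`. -/
theorem horner_step {X : Type*} [NormedCommRing X] [NormOneClass X] [NormedAlgebra ℝ X]
    {Y : Submodule ℝ X} {NY : X → ℝ} {B : X →ₗ[ℝ] X →ₗ[ℝ] X} {CD CM' K : ℝ}
    (hnonneg : ∀ y ∈ Y, 0 ≤ NY y)
    (hadd : ∀ y ∈ Y, ∀ y' ∈ Y, NY (y + y') ≤ NY y + NY y')
    (hsmul : ∀ c : ℝ, ∀ y ∈ Y, NY (c • y) = |c| * NY y)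
    (hD : ∀ x x' : X, x * x' - B x x' ∈ Y ∧ NY (x * x' - B x x') ≤ CD * ‖x‖ * ‖x'‖)
    (hM' : ∀ x : X, ∀ y ∈ Y, B x y ∈ Y ∧ NY (B x y) ≤ CM' * ‖x‖ * NY y)
    (hCD : CD ≤ K) (hCM' : CM' ≤ K) (hK : 0 ≤ K)
    {a b : ℝ} (hab : |a| + |b| ≤ K) {u q g : X} {M E : ℝ} (hM : 1 ≤ M)
    (hq : ‖q‖ ≤ M) (hqg : q - g ∈ Y) (hE : NY (q - g) ≤ E) :
    ‖u * (a • q + b • (1 : X))‖ ≤ (1 + ‖u‖) * (K * M) ∧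
      u * (a • q + b • (1 : X)) - B u (a • g + b • (1 : X)) ∈ Y ∧
      NY (u * (a • q + b • (1 : X)) - B u (a • g + b • (1 : X))) ≤
        K * (1 + ‖u‖) * (K * M) + K * (1 + ‖u‖) * (K * E) := by
  have hu : ‖u‖ ≤ 1 + ‖u‖ := by linarith
  have hu0 : 0 ≤ 1 + ‖u‖ := by positivity
  have hv : ‖a • q + b • (1 : X)‖ ≤ K * M := by
    calc ‖a • q + b • (1 : X)‖ ≤ |a| * ‖q‖ + |b| := by
          refine (norm_add_le _ _).trans_eq ?_
          simp [norm_smul]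
      _ ≤ |a| * M + |b| * M := by
          gcongr
          exact le_mul_of_one_le_right (abs_nonneg b) hM
      _ = (|a| + |b|) * M := by ring
      _ ≤ K * M := by gcongr
  have ha : |a| ≤ K := by linarith [abs_nonneg b]
  have hN := hnonneg _ hqg
  obtain ⟨hdY, hdN⟩ := hD u (a • q + b • (1 : X))
  obtain ⟨heY, heN⟩ := hM' u (a • (q - g)) (Y.smul_mem a hqg)
  have hsplit : u * (a • q + b • (1 : X)) - B u (a • g + b • (1 : X)) =
      (u * (a • q + b • (1 : X)) - B u (a • q + b • (1 : X))) + B u (a • (q - g)) := by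
    simp only [map_add, map_smul, map_sub, smul_sub]
    abel
  refine ⟨(norm_mul_le _ _).trans (by gcongr), ?_, ?_⟩
  · rw [hsplit]
    exact Y.add_mem hdY heY
  · rw [hsplit]
    refine (hadd _ hdY _ heY).trans (add_le_add (hdN.trans (by gcongr)) (heN.trans ?_))
    rw [hsmul a _ hqg]
    gcongr

/-- The phase-space error assertion of Proposition 7.1: the paraproduct network
recursion `h⁽ᵏ⁾ = B(u, a_k h⁽ᵏ⁻¹⁾ + b_k·1)` reproduces the Horner product
recursion `p⁽ᵏ⁾ = u·(a_k p⁽ᵏ⁻¹⁾ + b_k·1)` up to an error in the smoother space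
`Y`, with `‖p⁽ᴺ⁾ − h⁽ᴺ⁾‖_Y ≤ C (1 + ‖u‖_X)^{N+1}` and `C` depending only on
`N`, the constants `C_M, C_B, C_D, C_M′` and `max_k (|a_k| + |b_k|)`. -/
theorem stmt_12 (N : ℕ) (hN : 1 ≤ N) (CM CB CD CM' Cab : ℝ) :
    ∃ C : ℝ, 0 < C ∧
      ∀ (X : Type) [NormedCommRing X] [NormOneClass X] [NormedAlgebra ℝ X] [CompleteSpace X],
      ∀ (Y : Submodule ℝ X) (NY : X → ℝ),
        (∀ y ∈ Y, 0 ≤ NY y) →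
        (∀ y ∈ Y, ∀ y' ∈ Y, NY (y + y') ≤ NY y + NY y') →
        (∀ c : ℝ, ∀ y ∈ Y, NY (c • y) = |c| * NY y) →
        (∀ x : X, ∀ y ∈ Y, x * y ∈ Y ∧ NY (x * y) ≤ CM * ‖x‖ * NY y) →
      ∀ (B : X →ₗ[ℝ] X →ₗ[ℝ] X),
        (∀ x x' : X, ‖B x x'‖ ≤ CB * ‖x‖ * ‖x'‖) →
        (∀ x x' : X, x * x' - B x x' ∈ Y ∧ NY (x * x' - B x x') ≤ CD * ‖x‖ * ‖x'‖) →
        (∀ x : X, ∀ y ∈ Y, B x y ∈ Y ∧ NY (B x y) ≤ CM' * ‖x‖ * NY y) →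
      ∀ (a b : ℕ → ℝ), (∀ k : ℕ, |a k| + |b k| ≤ Cab) →
      ∀ (u : X) (p h : ℕ → X),
        p 1 = u * (a 1 • u + b 1 • (1 : X)) →
        (∀ k : ℕ, 2 ≤ k → k ≤ N → p k = u * (a k • p (k - 1) + b k • (1 : X))) →
        h 1 = B u (a 1 • u + b 1 • (1 : X)) →
        (∀ k : ℕ, 2 ≤ k → k ≤ N → h k = B u (a k • h (k - 1) + b k • (1 : X))) →
        p N - h N ∈ Y ∧ NY (p N - h N) ≤ C * (1 + ‖u‖) ^ (N + 1) := by
  set K : ℝ := 1 + |CD| + |CM'| + |Cab| with hKdef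
  have hK1 : 1 ≤ K := by linarith [abs_nonneg CD, abs_nonneg CM', abs_nonneg Cab]
  have hCD : CD ≤ K := by linarith [le_abs_self CD, abs_nonneg CM', abs_nonneg Cab]
  have hCM' : CM' ≤ K := by linarith [abs_nonneg CD, le_abs_self CM', abs_nonneg Cab]
  have hCab : Cab ≤ K := by linarith [abs_nonneg CD, abs_nonneg CM', le_abs_self Cab]
  have hK0 : 0 ≤ K := by linarith
  refine ⟨N * K ^ (2 * N), by positivity, ?_⟩
  intro X _ _ _ _ Y NY hnonneg hadd hsmul _ B _ hD hM' a b hab u p h hp1 hp hh1 hh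
  have hR1 : 1 ≤ 1 + ‖u‖ := by linarith [norm_nonneg u]
  have hstep (k : ℕ) {q g : X} {M E : ℝ} := horner_step hnonneg hadd hsmul hD hM' hCD hCM' hK0
    ((hab k).trans hCab) (u := u) (q := q) (g := g) (M := M) (E := E)
  have key : ∀ n : ℕ, n + 1 ≤ N → ‖p (n + 1)‖ ≤ K ^ (n + 1) * (1 + ‖u‖) ^ (n + 2) ∧
      p (n + 1) - h (n + 1) ∈ Y ∧
      NY (p (n + 1) - h (n + 1)) ≤
        ((n + 1 : ℕ) : ℝ) * K ^ (2 * (n + 1)) * (1 + ‖u‖) ^ (n + 2) := by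
    intro n
    induction n with
    | zero =>
      intro _
      have hzero : NY (u - u) ≤ 0 := by
        have := hsmul 0 0 Y.zero_mem
        simp_all
      obtain ⟨h₁, h₂, h₃⟩ := hstep 1 hR1 (by linarith) (by simp) hzero
      rw [zero_add, hp1, hh1]
      exact ⟨h₁.trans_eq (by ring), h₂, h₃.trans_eq (by push_cast; ring)⟩
    | succ n ih =>
      intro hn
      obtain ⟨ih₁, ih₂, ih₃⟩ := ih (by omega)
      have hM : 1 ≤ K ^ (n + 1) * (1 + ‖u‖) ^ (n + 2) :=
        one_le_mul_of_one_le_of_one_le (one_le_pow₀ hK1) (one_le_pow₀ hR1)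
      obtain ⟨h₁, h₂, h₃⟩ := hstep (n + 1 + 1) hM ih₁ ih₂ ih₃
      rw [hp (n + 1 + 1) (by omega) hn, hh (n + 1 + 1) (by omega) hn, Nat.add_sub_cancel]
      refine ⟨h₁.trans_eq (by ring), h₂, h₃.trans ?_⟩
      have hpow : K ^ (n + 3) ≤ K ^ (2 * (n + 2)) := pow_le_pow_right₀ hK1 (by omega)
      calc _ = K ^ (n + 3) * (1 + ‖u‖) ^ (n + 3) +
            (n + 1) * K ^ (2 * (n + 2)) * (1 + ‖u‖) ^ (n + 3) := by push_cast; ring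
        _ ≤ K ^ (2 * (n + 2)) * (1 + ‖u‖) ^ (n + 3) +
            (n + 1) * K ^ (2 * (n + 2)) * (1 + ‖u‖) ^ (n + 3) := by gcongr
        _ = _ := by push_cast; ring
  obtain ⟨n, rfl⟩ : ∃ n, N = n + 1 := ⟨N - 1, by omega⟩
  exact (key n le_rfl).2
end
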